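/- arXiv:0907.0454 — 3 statements merged into one kernel-verified Lean document; each statement's English description precedes it below -/
import Mathlib

section
/- Let f : S^4 → S^4 be a homeomorphism of the 4-sphere of odd prime order p (that is, f^p = id and f ≠ id). Then f has at least two fixed points. -/
/-- The 4-sphere: the unit sphere in 5-dimensional Euclidean space. -/
noncomputable abbrev S4 : Set (EuclideanSpace ℝ (Fin 5)) :=
  Metric.sphere (0 : EuclideanSpace ℝ (Fin 5)) 1

namespace SmithS4

open Finsupp

section alg

variable {R : Type} [CommRing R] {X : Type}

abbrev Ch (R : Type) [CommRing R] (X : Type) := List X →₀ R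

theorem ch_ext {M : Type} [AddCommGroup M] [Module R M] {F G : Ch R X →ₗ[R] M}
    (h : ∀ l, F (single l 1) = G (single l 1)) : F = G := by
  apply Finsupp.lhom_ext'
  intro l
  apply LinearMap.ext_ring
  simpa using h l

theorem lin_mem {M : Type} [AddCommGroup M] [Module R M] (F : Ch R X →ₗ[R] M)
    (S : Set (List X)) (P : Submodule R M) (h : ∀ l ∈ S, F (single l 1) ∈ P)
    {c : Ch R X} (hc : c ∈ Finsupp.supported R R S) : F c ∈ P := by
  have : Finsupp.supported R R S ≤ P.comap F := by
    rw [Finsupp.supported_eq_span_single, Submodule.span_le]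
    rintro _ ⟨l, hl, rfl⟩
    exact h l hl
  exact this hc

theorem lin_eq {M : Type} [AddCommGroup M] [Module R M] (F G : Ch R X →ₗ[R] M)
    (S : Set (List X)) (h : ∀ l ∈ S, F (single l 1) = G (single l 1))
    {c : Ch R X} (hc : c ∈ Finsupp.supported R R S) : F c = G c := by
  have := lin_mem (F - G) S ⊥ (fun l hl => by simp [h l hl]) hc
  simpa [sub_eq_zero] using this

noncomputable def cone (x : X) : Ch R X →ₗ[R] Ch R X := Finsupp.lmapDomain R R (List.cons x)

noncomputable def push {Y : Type} (f : X → Y) : Ch R X →ₗ[R] Ch R Y :=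
  Finsupp.lmapDomain R R (List.map f)

@[simp] theorem cone_single (x : X) (l : List X) (r : R) :
    cone x (single l r) = single (x :: l) r := by simp [cone]

@[simp] theorem push_single {Y : Type} (f : X → Y) (l : List X) (r : R) :
    push f (single l r) = single (l.map f) r := by simp [push]

noncomputable def bdL : List X → Ch R X
  | [] => 0
  | x :: l => single l 1 - cone x (bdL l)

noncomputable def bd : Ch R X →ₗ[R] Ch R X := Finsupp.linearCombination R bdL

@[simp] theorem bd_single (l : List X) : bd (R := R) (single l 1) = bdL l := by simp [bd]

theorem bd_cone (x : X) (c : Ch R X) : bd (cone x c) = c - cone x (bd c) := by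
  have : bd ∘ₗ cone x = LinearMap.id - cone x ∘ₗ bd (R := R) := by
    apply ch_ext; intro l; simp [bdL]
  exact LinearMap.congr_fun this c

theorem bd_bd (c : Ch R X) : bd (bd c) = 0 := by
  have : bd ∘ₗ bd = (0 : Ch R X →ₗ[R] Ch R X) := by
    apply ch_ext; intro l
    induction l with
    | nil => simp [bdL]
    | cons x l ih =>
      simp only [LinearMap.comp_apply, bd_single, LinearMap.zero_apply] at ih
      simp [bdL, bd_cone, ih]
  exact LinearMap.congr_fun this c

theorem push_cone {Y : Type} (f : X → Y) (x : X) (c : Ch R X) :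
    push f (cone x c) = cone (f x) (push f c) := by
  have : push f ∘ₗ cone x = cone (f x) ∘ₗ push (R := R) f := by
    apply ch_ext; intro l; simp
  exact LinearMap.congr_fun this c

theorem bd_push {Y : Type} (f : X → Y) (c : Ch R X) : bd (push f c) = push f (bd c) := by
  have : bd ∘ₗ push f = push f ∘ₗ bd (R := R) := by
    apply ch_ext; intro l
    induction l with
    | nil => simp [bdL]
    | cons x l ih =>
      simp only [LinearMap.comp_apply, bd_single, push_single] at ih
      simp [bdL, push_cone, ih]
  exact LinearMap.congr_fun this c

theorem push_push {Y Z : Type} (f : X → Y) (g : Y → Z) (c : Ch R X) :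
    push g (push f c) = push (g ∘ f) c := by
  have : push g ∘ₗ push f = push (R := R) (g ∘ f) := by
    apply ch_ext; intro l; simp
  exact LinearMap.congr_fun this c

theorem push_id (c : Ch R X) : push id c = c := by
  have : push id = (LinearMap.id : Ch R X →ₗ[R] Ch R X) := by
    apply ch_ext; intro l; simp
  exact LinearMap.congr_fun this c

/-- prism operator -/
noncomputable def prL (f g : X → X) : List X → Ch R X
  | [] => 0
  | x :: l => single (f x :: g x :: l.map g) 1 - cone (f x) (prL f g l)

noncomputable def pr (f g : X → X) : Ch R X →ₗ[R] Ch R X := Finsupp.linearCombination R (prL f g)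

@[simp] theorem pr_single (f g : X → X) (l : List X) :
    pr (R := R) f g (single l 1) = prL f g l := by simp [pr]

theorem pr_cone (f g : X → X) (x : X) (c : Ch R X) :
    pr f g (cone x c) = cone (f x) (cone (g x) (push g c)) - cone (f x) (pr f g c) := by
  have : pr f g ∘ₗ cone x = cone (f x) ∘ₗ cone (g x) ∘ₗ push g - cone (f x) ∘ₗ pr (R := R) f g := by
    apply ch_ext; intro l; simp [prL]
  exact LinearMap.congr_fun this c

theorem bd_pr (f g : X → X) (c : Ch R X) :
    bd (pr f g c) + pr f g (bd c) = push g c - push f c := by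
  have : bd ∘ₗ pr f g + pr f g ∘ₗ bd = push g - push (R := R) f := by
    apply ch_ext; intro l
    induction l with
    | nil => simp [bdL, prL]
    | cons x l ih =>
      simp only [LinearMap.comp_apply, bd_single, push_single, LinearMap.add_apply,
        LinearMap.sub_apply, pr_single] at ih
      have h2 := congrArg (cone (f x)) ih
      have h3 := bd_push (R := R) g (single l 1)
      simp only [push_single, bd_single] at h3
      simp only [map_add, map_sub, cone_single] at h2
      simp only [LinearMap.comp_apply, bd_single, push_single, LinearMap.add_apply,
        LinearMap.sub_apply, pr_single, prL, bdL, map_sub, bd_cone, pr_cone, List.map_cons,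
        cone_single, h3]
      rw [← sub_eq_zero] at h2 ⊢
      rw [← h2]
      abel
  exact LinearMap.congr_fun this c

/-- the boundary of a list is supported on lists with entries in the list -/
theorem bdL_supp (l : List X) :
    bdL (R := R) l ∈ Finsupp.supported R R {m : List X | ∀ x ∈ m, x ∈ l} := by
  induction l with
  | nil => simp [bdL]
  | cons a l ih =>
    apply Submodule.sub_mem
    · apply Finsupp.single_mem_supported
      intro x hx; exact List.mem_cons_of_mem _ hx
    · apply lin_mem _ _ _ _ ih
      intro m hm
      rw [cone_single]
      apply Finsupp.single_mem_supported
      intro x hx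
      rcases List.mem_cons.1 hx with rfl | hx
      · simp
      · exact List.mem_cons_of_mem _ (hm x hx)

theorem prL_supp (f g : X → X) (l : List X) :
    prL (R := R) f g l ∈ Finsupp.supported R R
      {m : List X | ∀ x ∈ m, ∃ y ∈ l, x = f y ∨ x = g y} := by
  induction l with
  | nil => simp [prL]
  | cons a l ih =>
    apply Submodule.sub_mem
    · apply Finsupp.single_mem_supported
      intro x hx
      simp only [List.mem_cons, List.mem_map] at hx
      rcases hx with rfl | rfl | ⟨b, hb, rfl⟩
      · exact ⟨a, by simp, Or.inl rfl⟩
      · exact ⟨a, by simp, Or.inr rfl⟩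
      · exact ⟨b, by simp [hb], Or.inr rfl⟩
    · apply lin_mem _ _ _ _ ih
      intro m hm
      rw [cone_single]
      apply Finsupp.single_mem_supported
      intro x hx
      rcases List.mem_cons.1 hx with rfl | hx
      · exact ⟨a, by simp, Or.inl rfl⟩
      · obtain ⟨y, hy, h⟩ := hm x hx
        exact ⟨y, List.mem_cons_of_mem _ hy, h⟩

/-- norm and difference operators -/
noncomputable def Bn (R : Type) [CommRing R] (g : X → X) (n : ℕ) : Ch R X →ₗ[R] Ch R X :=
  ∑ k ∈ Finset.range n, push g^[k]

noncomputable def Bd (R : Type) [CommRing R] (g : X → X) : Ch R X →ₗ[R] Ch R X :=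
  push g - LinearMap.id

theorem Bn_apply (g : X → X) (n : ℕ) (c : Ch R X) :
    Bn R g n c = ∑ k ∈ Finset.range n, push g^[k] c := by simp [Bn]

theorem Bd_apply (g : X → X) (c : Ch R X) : Bd R g c = push g c - c := by simp [Bd]

theorem bd_Bn (g : X → X) (n : ℕ) (c : Ch R X) : bd (Bn R g n c) = Bn R g n (bd c) := by
  simp [Bn_apply, bd_push]

theorem bd_Bd (g : X → X) (c : Ch R X) : bd (Bd R g c) = Bd R g (bd c) := by
  simp [Bd_apply, bd_push]

theorem Bn_Bd (g : X → X) (n : ℕ) (hg : g^[n] = id) (c : Ch R X) : Bn R g n (Bd R g c) = 0 := by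
  simp only [Bn_apply, Bd_apply, map_sub, push_push, ← Function.iterate_succ]
  rw [← Finset.sum_sub_distrib, Finset.sum_range_sub (fun k => push g^[k] c), hg]
  simp

theorem Bd_Bn (g : X → X) (n : ℕ) (hg : g^[n] = id) (c : Ch R X) : Bd R g (Bn R g n c) = 0 := by
  simp only [Bn_apply, Bd_apply, map_sum, push_push, ← Function.iterate_succ']
  rw [Finset.sum_range_sub (fun k => push g^[k] c), hg]
  simp

end alg


section coch

variable {R : Type} [CommRing R] {X : Type}

noncomputable def Oc (g : X → X) (n : ℕ) (ℓ : X → ZMod n) (w : ℕ → ZMod n → R)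
    (φ : Ch R X →ₗ[R] R) : Ch R X →ₗ[R] R :=
  Finsupp.linearCombination R (fun l : List X => match l with
    | [] => 0
    | x :: t => ∑ r ∈ Finset.range n, w r (ℓ x) * φ (push g^[r] (single (x :: t) 1)))

theorem Oc_nil (g : X → X) (n : ℕ) (ℓ : X → ZMod n) (w : ℕ → ZMod n → R)
    (φ : Ch R X →ₗ[R] R) : Oc g n ℓ w φ (single [] 1) = 0 := by
  simp [Oc]

theorem Oc_cons (g : X → X) (n : ℕ) (ℓ : X → ZMod n) (w : ℕ → ZMod n → R)
    (φ : Ch R X →ₗ[R] R) (x : X) (t : List X) : Oc g n ℓ w φ (single (x :: t) 1) =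
      ∑ r ∈ Finset.range n, w r (ℓ x) * φ (push g^[r] (single (x :: t) 1)) := by
  simp [Oc]

theorem Oc_const (g : X → X) (n : ℕ) (ℓ : X → ZMod n) (w : ℕ → ZMod n → R)
    (φ : Ch R X →ₗ[R] R) (h0 : φ (single [] 1) = 0) (k : ZMod n) {c : Ch R X}
    (hc : c ∈ Finsupp.supported R R {l : List X | ∀ x ∈ l, ℓ x = k}) :
    Oc g n ℓ w φ c = ∑ r ∈ Finset.range n, w r k * φ (push g^[r] c) := by
  have := lin_eq (Oc g n ℓ w φ) (∑ r ∈ Finset.range n, w r k • (φ ∘ₗ push g^[r])) _ ?_ hc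
  · rw [this]; simp
  · intro l hl
    cases l with
    | nil => simp [Oc_nil, h0]
    | cons x t =>
      rw [Oc_cons]
      have : ℓ x = k := hl x (by simp)
      simp [this]

theorem lab_iter {g : X → X} {n : ℕ} {ℓ : X → ZMod n} (hℓ : ∀ x, ℓ (g x) = ℓ x + 1) (r : ℕ) (x : X) :
    ℓ (g^[r] x) = ℓ x + r := by
  induction r with
  | zero => simp
  | succ r ih => rw [Function.iterate_succ_apply', hℓ, ih]; push_cast; ring

/-- constant label -/
def CL {n : ℕ} (ℓ : X → ZMod n) (l : List X) : Prop := ∃ k, ∀ x ∈ l, ℓ x = k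

theorem Oc_vanish (g : X → X) (n : ℕ) (ℓ ℓ' : X → ZMod n) (hℓ' : ∀ x, ℓ' (g x) = ℓ' x + 1)
    (w : ℕ → ZMod n → R) (φ : Ch R X →ₗ[R] R)
    (hφ : ∀ l, CL ℓ' l → φ (single l 1) = 0) (l : List X) (hl : CL ℓ' l) :
    Oc g n ℓ w φ (single l 1) = 0 := by
  cases l with
  | nil => exact Oc_nil ..
  | cons x t =>
    rw [Oc_cons]
    apply Finset.sum_eq_zero
    intro r _
    rw [push_single, hφ, mul_zero]
    obtain ⟨k, hk⟩ := hl
    refine ⟨k + r, ?_⟩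
    intro y hy
    obtain ⟨z, hz, rfl⟩ := List.mem_map.1 hy
    rw [lab_iter hℓ', hk z hz]

theorem bd_CL {n : ℕ} (ℓ : X → ZMod n) (φ : Ch R X →ₗ[R] R)
    (hφ : ∀ l, CL ℓ l → φ (single l 1) = 0) (l : List X) (hl : CL ℓ l) :
    φ (bd (single l 1)) = 0 := by
  rw [bd_single]
  have := lin_mem φ _ ⊥ ?_ (bdL_supp (R := R) l)
  · simpa using this
  · intro m hm
    obtain ⟨k, hk⟩ := hl
    simpa using hφ m ⟨k, fun x hx => hk x (hm x hx)⟩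

def wP (R : Type) [CommRing R] (n : ℕ) (r : ℕ) (k : ZMod n) : R := if r = 0 ∧ k = 0 then 1 else 0
def wQ (R : Type) [CommRing R] (n : ℕ) (r : ℕ) (k : ZMod n) : R := if n - k.val ≤ r then 1 else 0

theorem OcP (g : X → X) (n : ℕ) [NeZero n] (ℓ : X → ZMod n) (hℓ : ∀ x, ℓ (g x) = ℓ x + 1)
    (φ : Ch R X →ₗ[R] R) (h0 : φ (single [] 1) = 0) (hφ : ∀ c, φ (Bd R g c) = 0) (c : Ch R X) :
    Oc g n ℓ (wP R n) φ (Bn R g n c) = φ c := by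
  have hinv : ∀ r c, φ (push g^[r] c) = φ c := by
    intro r
    induction r with
    | zero => intro c; simp [push_id]
    | succ r ih =>
      intro c
      have := hφ (push g^[r] c)
      rw [Bd_apply, map_sub, sub_eq_zero, push_push, ← Function.iterate_succ'] at this
      rw [this, ih]
  have : Oc g n ℓ (wP R n) φ ∘ₗ Bn R g n = φ := by
    apply ch_ext
    intro l
    rw [LinearMap.comp_apply, Bn_apply, map_sum]
    cases l with
    | nil => simp [Oc_nil, h0]
    | cons x t =>
      have hn : 0 < n := Nat.pos_of_ne_zero (NeZero.ne n)
      rw [Finset.sum_eq_single (-ℓ x).val]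
      · rw [push_single, List.map_cons, Oc_cons, Finset.sum_eq_single 0]
        · have : wP R n 0 (ℓ (g^[(-ℓ x).val] x)) = 1 := by
            simp [wP, lab_iter hℓ]
          rw [this, one_mul, hinv, ← List.map_cons, ← push_single, hinv]
        · intro r _ hr
          simp [wP, hr]
        · simp [hn.ne']
      · intro k hk hne
        rw [push_single, List.map_cons, Oc_cons]
        apply Finset.sum_eq_zero
        intro r _
        have : wP R n r (ℓ (g^[k] x)) = 0 := by
          rw [wP, if_neg]
          rintro ⟨_, h⟩
          apply hne
          rw [lab_iter hℓ] at h
          have : (k : ZMod n) = - ℓ x := by linear_combination h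
          rw [← this, ZMod.val_natCast, Nat.mod_eq_of_lt (Finset.mem_range.1 hk)]
        rw [this, zero_mul]
      · intro h
        exact absurd (Finset.mem_range.2 (ZMod.val_lt _)) h
  exact LinearMap.congr_fun this c

theorem OcQ (g : X → X) (n : ℕ) [NeZero n] (hg : g^[n] = id) (ℓ : X → ZMod n)
    (hℓ : ∀ x, ℓ (g x) = ℓ x + 1)
    (φ : Ch R X →ₗ[R] R) (h0 : φ (single [] 1) = 0) (hφ : ∀ c, φ (Bn R g n c) = 0) (c : Ch R X) :
    Oc g n ℓ (wQ R n) φ (Bd R g c) = φ c := by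
  have hn : 0 < n := Nat.pos_of_ne_zero (NeZero.ne n)
  have key : ∀ x t, Oc g n ℓ (wQ R n) φ (single (x :: t) 1) =
      ∑ r ∈ Finset.Ico (n - (ℓ x).val) n, φ (push g^[r] (single (x :: t) 1)) := by
    intro x t
    rw [Oc_cons]
    rw [← Finset.sum_subset (s₁ := Finset.Ico (n - (ℓ x).val) n)]
    · apply Finset.sum_congr rfl
      intro r hr
      rw [wQ, if_pos (Finset.mem_Ico.1 hr).1, one_mul]
    · intro r hr
      exact Finset.mem_range.2 (Finset.mem_Ico.1 hr).2
    · intro r hr hr'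
      rw [wQ, if_neg, zero_mul]
      intro h
      exact hr' (Finset.mem_Ico.2 ⟨h, Finset.mem_range.1 hr⟩)
  have : Oc g n ℓ (wQ R n) φ ∘ₗ Bd R g = φ := by
    apply ch_ext
    intro l
    rw [LinearMap.comp_apply, Bd_apply, map_sub]
    cases l with
    | nil => simp [Oc_nil, h0]
    | cons x t =>
      have e : ∀ r, φ (push g^[r] (single (List.map g (x :: t)) 1)) =
          φ (push g^[r + 1] (single (x :: t) 1)) := by
        intro r
        rw [← push_single, push_push, ← Function.iterate_succ]
      have hN := hφ (single (x :: t) 1)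
      rw [Bn_apply, map_sum, Finset.range_eq_Ico, Finset.sum_eq_sum_Ico_succ_bot hn] at hN
      have e0 : φ (push g^[0] (single (x :: t) 1)) = φ (single (x :: t) 1) := by simp
      rw [push_single, List.map_cons, key, key, ← List.map_cons]
      simp only [e]
      rw [Finset.sum_Ico_add' (fun r => φ (push g^[r] (single (x :: t) 1))), hℓ]
      have hlt := ZMod.val_lt (ℓ x)
      rcases Nat.lt_or_ge ((ℓ x).val + 1) n with h | h
      · have hv : (ℓ x + 1).val = (ℓ x).val + 1 := by
          have h1n : 1 < n := by omega
          have : Fact (1 < n) := ⟨h1n⟩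
          rw [ZMod.val_add_of_lt, ZMod.val_one]
          rw [ZMod.val_one]; exact h
        rw [hv]
        have : n - ((ℓ x).val + 1) + 1 = n - (ℓ x).val := by omega
        rw [this, Finset.sum_Ico_succ_top (by omega), hg]
        simp
      · have hv : ℓ x + 1 = 0 := by
          have h1 : (ℓ x).val + 1 = n := by omega
          have h2 : (((ℓ x).val + 1 : ℕ) : ZMod n) = 0 := by rw [h1]; simp
          simpa using h2
        have h1 : n - (ℓ x).val = 1 := by omega
        rw [hv, h1]
        rw [e0] at hN
        simp only [zero_add] at hN
        simp
        simp at hN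
        linear_combination -hN
  exact LinearMap.congr_fun this c

noncomputable def eps (R : Type) [CommRing R] (X : Type) : Ch R X →ₗ[R] R :=
  Finsupp.linearCombination R (fun l : List X => if l.length = 1 then (1 : R) else 0)

theorem eps_single (l : List X) : eps R X (single l 1) = if l.length = 1 then (1 : R) else 0 := by
  simp [eps]

theorem eps_bd (c : Ch R X) : eps R X (bd c) = 0 := by
  set θ : Ch R X →ₗ[R] R := Finsupp.linearCombination R
    (fun l : List X => if l.length = 0 then (1 : R) else 0) with hθ
  have hθc : ∀ x c, θ (cone x c) = 0 := by
    intro x c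
    have : θ ∘ₗ cone x = 0 := by
      apply ch_ext; intro l; simp [hθ]
    exact LinearMap.congr_fun this c
  have : eps R X = θ ∘ₗ bd := by
    apply ch_ext
    intro l
    rw [eps_single, LinearMap.comp_apply, bd_single]
    cases l with
    | nil => simp [bdL]
    | cons x t => simp [bdL, hθc]; simp [hθ]
  rw [this, LinearMap.comp_apply, bd_bd, map_zero]

theorem eps_Bd (g : X → X) (c : Ch R X) : eps R X (Bd R g c) = 0 := by
  have : eps R X ∘ₗ Bd R g = 0 := by
    apply ch_ext
    intro l
    simp [Bd_apply, eps_single]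
  exact LinearMap.congr_fun this c

noncomputable def Bop (R : Type) [CommRing R] (g : X → X) (n : ℕ) (i : ℕ) : Ch R X →ₗ[R] Ch R X :=
  if Even i then Bn R g n else Bd R g

theorem bd_Bop (g : X → X) (n i : ℕ) (c : Ch R X) : bd (Bop R g n i c) = Bop R g n i (bd c) := by
  unfold Bop; split_ifs
  · exact bd_Bn ..
  · exact bd_Bd ..

theorem Bop_Bop (g : X → X) (n i : ℕ) (hg : g^[n] = id) (c : Ch R X) :
    Bop R g n (i + 1) (Bop R g n i c) = 0 := by
  unfold Bop
  by_cases h : Even i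
  · have : ¬ Even (i + 1) := by simpa [Nat.even_add_one] using h
    rw [if_neg this, if_pos h, Bd_Bn g n hg]
  · have : Even (i + 1) := by simpa [Nat.even_add_one] using h
    rw [if_pos this, if_neg h, Bn_Bd g n hg]

theorem coch (g : X → X) (n : ℕ) [NeZero n] (hg : g^[n] = id) (ℓ : ℕ → X → ZMod n)
    (hℓ : ∀ i x, ℓ i (g x) = ℓ i x + 1) :
    ∃ h : ℕ → (Ch R X →ₗ[R] R),
      (∀ c, h 0 (Bop R g n 0 c) = eps R X c) ∧
      (∀ i c, h (i + 1) (Bop R g n (i + 1) c) = h i (bd c)) ∧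
      (∀ i j, j ≤ i → ∀ l, CL (ℓ j) l → h i (bd (single l 1)) = 0) := by
  let W : ℕ → ℕ → ZMod n → R := fun i => if Even i then wP R n else wQ R n
  let phi : ℕ → (Ch R X →ₗ[R] R) := fun i =>
    Nat.rec (eps R X) (fun i φ => (Oc g n (ℓ i) (W i) φ) ∘ₗ bd) i
  have phis : ∀ i, phi (i + 1) = (Oc g n (ℓ i) (W i) (phi i)) ∘ₗ bd := fun i => rfl
  let h : ℕ → (Ch R X →ₗ[R] R) := fun i => Oc g n (ℓ i) (W i) (phi i)
  have hB : ∀ i, phi i (single [] 1) = 0 → (∀ c, phi i (Bop R g n (i + 1) c) = 0) →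
      ∀ c, h i (Bop R g n i c) = phi i c := by
    intro i h0 hb c
    by_cases he : Even i
    · have he' : ¬ Even (i + 1) := by simpa [Nat.even_add_one] using he
      simp only [Bop, if_neg he'] at hb
      simp only [h, W, Bop, if_pos he]
      exact OcP g n (ℓ i) (hℓ i) _ h0 hb c
    · have he' : Even (i + 1) := by simpa [Nat.even_add_one] using he
      simp only [Bop, if_pos he'] at hb
      simp only [h, W, Bop, if_neg he]
      exact OcQ g n hg (ℓ i) (hℓ i) _ h0 hb c
  have inv : ∀ i, phi i (single [] 1) = 0 ∧ (∀ c, phi i (bd c) = 0) ∧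
      (∀ c, phi i (Bop R g n (i + 1) c) = 0) := by
    intro i
    induction i with
    | zero =>
      refine ⟨by simp [phi, eps_single], fun c => eps_bd c, fun c => ?_⟩
      simp only [Bop]
      exact eps_Bd g c
    | succ i ih =>
      obtain ⟨h0, h1, h2⟩ := ih
      refine ⟨?_, ?_, ?_⟩
      · rw [phis]; simp [bdL]
      · intro c; rw [phis]; simp [bd_bd]
      · intro c
        rw [phis, LinearMap.comp_apply, bd_Bop]
        have e : Bop R g n (i + 1 + 1) = Bop R g n i := by
          simp [Bop, Nat.even_add_one]
        rw [e]
        have := hB i h0 h2 (bd c)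
        simp only [h] at this
        rw [this, h1]
  refine ⟨h, fun c => hB 0 (inv 0).1 (inv 0).2.2 c, fun i c => ?_, ?_⟩
  · rw [hB (i + 1) (inv (i + 1)).1 (inv (i + 1)).2.2]; rfl
  · intro i
    induction i with
    | zero =>
      intro j hj l hl
      obtain rfl : j = 0 := by omega
      obtain ⟨k, hk⟩ := hl
      have := Oc_const g n (ℓ 0) (W 0) (phi 0) (inv 0).1 k (c := bd (single l 1)) ?_
      · simp only [h]; rw [this]
        apply Finset.sum_eq_zero
        intro r _
        rw [← bd_push, (inv 0).2.1, mul_zero]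
      · rw [bd_single]
        refine Finsupp.supported_mono (s := {m : List X | ∀ x ∈ m, x ∈ l}) ?_ (bdL_supp l)
        exact fun m hm x hx => hk x (hm x hx)
    | succ i ih =>
      intro j hj l hl
      rcases Nat.lt_or_ge i j with hij | hij
      · obtain rfl : j = i + 1 := by omega
        obtain ⟨k, hk⟩ := hl
        have := Oc_const g n (ℓ (i + 1)) (W (i + 1)) (phi (i + 1)) (inv (i + 1)).1 k
          (c := bd (single l 1)) ?_
        · simp only [h]; rw [this]
          apply Finset.sum_eq_zero
          intro r _
          rw [← bd_push, (inv (i + 1)).2.1, mul_zero]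
        · rw [bd_single]
          refine Finsupp.supported_mono (s := {m : List X | ∀ x ∈ m, x ∈ l}) ?_ (bdL_supp l)
          exact fun m hm x hx => hk x (hm x hx)
      · apply bd_CL (ℓ j) _ _ l hl
        exact Oc_vanish g n _ (ℓ j) (hℓ j) _ _ (ih j hij)

end coch


section topo

variable {R : Type} [CommRing R] {X : Type} [MetricSpace X]

def Sm (K : Set X) (ε : ℝ) : Set (List X) :=
  {l | (∀ x ∈ l, x ∈ K) ∧ ∀ x ∈ l, ∀ y ∈ l, dist x y < ε}

theorem hom_lemma (K : Set X) (hK : IsCompact K) (H : unitInterval × X → X)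
    (hH : ContinuousOn H (Set.univ ×ˢ K)) (ε : ℝ) (hε : 0 < ε) :
    ∃ δ > 0, ∀ c ∈ Finsupp.supported R R (Sm K δ), bd c = 0 →
      ∃ d ∈ Finsupp.supported R R (Sm (H '' (Set.univ ×ˢ K)) ε),
        bd d = push (fun x => H (1, x)) c - push (fun x => H (0, x)) c := by
  have hcomp : IsCompact ((Set.univ : Set unitInterval) ×ˢ K) := isCompact_univ.prod hK
  have huc := hcomp.uniformContinuousOn_of_continuous hH
  obtain ⟨δ, hδ, hd⟩ := Metric.uniformContinuousOn_iff.1 huc ε hε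
  obtain ⟨m, hm⟩ := exists_nat_gt (1 / δ)
  have hm0 : (0 : ℝ) < m := lt_trans (by positivity) hm
  let τ : ℕ → unitInterval := fun s => Set.projIcc (0 : ℝ) 1 zero_le_one (s / m)
  have hτ0 : τ 0 = 0 := by
    simp only [τ, Nat.cast_zero, zero_div]
    exact Set.projIcc_left _
  have hτm : τ m = 1 := by
    simp only [τ]
    rw [div_self hm0.ne']
    exact Set.projIcc_right _
  have hττ : ∀ s, dist (τ s) (τ (s + 1)) < δ := by
    intro s
    have h1 := (LipschitzWith.projIcc (a := (0 : ℝ)) (b := 1) zero_le_one).dist_le_mul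
      ((s : ℝ) / m) (((s + 1 : ℕ) : ℝ) / m)
    refine lt_of_le_of_lt h1 ?_
    rw [Real.dist_eq]
    have : (s : ℝ) / m - ((s + 1 : ℕ) : ℝ) / m = - (1 / m) := by push_cast; ring
    rw [this, abs_neg, abs_of_pos (by positivity)]
    simp only [NNReal.coe_one, one_mul]
    rw [div_lt_iff₀ hδ] at hm
    rw [div_lt_iff₀ hm0]; linarith
  refine ⟨δ, hδ, fun c hc hbc => ?_⟩
  refine ⟨∑ s ∈ Finset.range m, pr (fun x => H (τ s, x)) (fun x => H (τ (s + 1), x)) c, ?_, ?_⟩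
  · apply Submodule.sum_mem
    intro s _
    refine lin_mem _ _ _ ?_ hc
    intro l hl
    rw [pr_single]
    refine Finsupp.supported_mono ?_ (prL_supp _ _ l)
    intro u hu
    refine ⟨?_, ?_⟩
    · intro x hx
      obtain ⟨y, hy, rfl | rfl⟩ := hu x hx
      · exact ⟨_, ⟨Set.mem_univ _, hl.1 y hy⟩, rfl⟩
      · exact ⟨_, ⟨Set.mem_univ _, hl.1 y hy⟩, rfl⟩
    · intro x hx x' hx'
      obtain ⟨y, hy, h⟩ := hu x hx
      obtain ⟨y', hy', h'⟩ := hu x' hx'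
      have hyy := hl.2 y hy y' hy'
      have s1 := hττ s
      have s2 : dist (τ (s + 1)) (τ s) < δ := by rw [dist_comm]; exact s1
      rcases h with rfl | rfl <;> rcases h' with rfl | rfl <;>
        refine hd _ ⟨Set.mem_univ _, hl.1 y hy⟩ _ ⟨Set.mem_univ _, hl.1 y' hy'⟩ ?_ <;>
        rw [Prod.dist_eq, max_lt_iff] <;> refine ⟨?_, hyy⟩ <;> simp [hδ, s1, s2]
  · rw [map_sum]
    have : ∀ s ∈ Finset.range m, bd (pr (fun x => H (τ s, x)) (fun x => H (τ (s + 1), x)) c) =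
        push (fun x => H (τ (s + 1), x)) c - push (fun x => H (τ s, x)) c := by
      intro s _
      have := bd_pr (fun x => H (τ s, x)) (fun x => H (τ (s + 1), x)) c
      rw [hbc, map_zero, add_zero] at this
      exact this
    rw [Finset.sum_congr rfl this, Finset.sum_range_sub (fun s => push (fun x => H (τ s, x)) c),
      hτ0, hτm]

theorem fill_lemma (K : Set X) (hK : IsCompact K) (H : unitInterval × X → X) (q : X)
    (hH : ContinuousOn H (Set.univ ×ˢ K)) (h0 : ∀ x ∈ K, H (0, x) = x)
    (h1 : ∀ x ∈ K, H (1, x) = q) (ε : ℝ) (hε : 0 < ε) :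
    ∃ δ > 0, ∀ c ∈ Finsupp.supported R R (Sm K δ), bd c = 0 →
      ∃ d ∈ Finsupp.supported R R (Sm (insert q (H '' (Set.univ ×ˢ K))) ε), bd d = c := by
  obtain ⟨δ, hδ, hd⟩ := hom_lemma (R := R) K hK H hH ε hε
  refine ⟨δ, hδ, fun c hc hbc => ?_⟩
  obtain ⟨d, hds, hdb⟩ := hd c hc hbc
  have e0 : push (fun x => H (0, x)) c = c := by
    refine lin_eq (push (fun x => H (0, x))) LinearMap.id _ ?_ hc
    intro l hl
    simp only [push_single, LinearMap.id_apply]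
    congr 1
    conv_rhs => rw [← List.map_id l]
    exact List.map_congr_left (fun x hx => h0 x (hl.1 x hx))
  refine ⟨cone q (push (fun x => H (1, x)) c) - d, ?_, ?_⟩
  · apply Submodule.sub_mem
    · refine lin_mem (cone q ∘ₗ push (fun x => H (1, x))) _ _ ?_ hc
      intro l hl
      simp only [LinearMap.comp_apply, push_single, cone_single]
      apply Finsupp.single_mem_supported
      have : ∀ x ∈ q :: l.map (fun x => H (1, x)), x = q := by
        intro x hx
        rcases List.mem_cons.1 hx with rfl | hx
        · rfl
        · obtain ⟨y, hy, rfl⟩ := List.mem_map.1 hx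
          exact h1 y (hl.1 y hy)
      refine ⟨fun x hx => ?_, fun x hx y hy => ?_⟩
      · rw [this x hx]; exact Set.mem_insert _ _
      · rw [this x hx, this y hy, dist_self]; exact hε
    · refine Finsupp.supported_mono ?_ hds
      intro l hl
      exact ⟨fun x hx => Set.mem_insert_of_mem _ (hl.1 x hx), hl.2⟩
  · rw [map_sub, hdb, bd_cone, bd_push, hbc, e0]
    simp

theorem push_small (K : Set X) (hK : IsCompact K) (g : X → X) (hg : Continuous g)
    (ε : ℝ) (hε : 0 < ε) :
    ∃ δ > 0, ∀ c ∈ Finsupp.supported R R (Sm K δ),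
      push g c ∈ Finsupp.supported R R (Sm (g '' K) ε) := by
  have huc := hK.uniformContinuousOn_of_continuous hg.continuousOn
  obtain ⟨δ, hδ, hd⟩ := Metric.uniformContinuousOn_iff.1 huc ε hε
  refine ⟨δ, hδ, fun c hc => ?_⟩
  refine lin_mem _ _ _ ?_ hc
  intro l hl
  rw [push_single]
  apply Finsupp.single_mem_supported
  refine ⟨fun x hx => ?_, fun x hx y hy => ?_⟩
  · obtain ⟨z, hz, rfl⟩ := List.mem_map.1 hx
    exact ⟨z, hl.1 z hz, rfl⟩
  · obtain ⟨z, hz, rfl⟩ := List.mem_map.1 hx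
    obtain ⟨w, hw, rfl⟩ := List.mem_map.1 hy
    exact hd z (hl.1 z hz) w (hl.1 w hw) (hl.2 z hz w hw)

theorem Sm_mono {K K' : Set X} {ε ε' : ℝ} (h : K ⊆ K') (he : ε ≤ ε') : Sm K ε ⊆ Sm K' ε' :=
  fun _ hl => ⟨fun x hx => h (hl.1 x hx), fun x hx y hy => (hl.2 x hx y hy).trans_le he⟩

def orb (g : X → X) (n : ℕ) (K : Set X) : Set X := ⋃ k ∈ Finset.range (n + 1), g^[k] '' K

theorem orb_compact (g : X → X) (hg : Continuous g) (n : ℕ) (K : Set X) (hK : IsCompact K) :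
    IsCompact (orb g n K) :=
  (Finset.range (n + 1)).isCompact_biUnion (fun k _ => hK.image (hg.iterate k))

theorem Bop_small (K : Set X) (hK : IsCompact K) (g : X → X) (hg : Continuous g) (n : ℕ)
    (hn : 0 < n) (i : ℕ) (ε : ℝ) (hε : 0 < ε) :
    ∃ δ > 0, ∀ c ∈ Finsupp.supported R R (Sm K δ),
      Bop R g n i c ∈ Finsupp.supported R R (Sm (orb g n K) ε) := by
  have h1 : ∀ k, ∃ δ > 0, ∀ c ∈ Finsupp.supported R R (Sm K δ),
      push g^[k] c ∈ Finsupp.supported R R (Sm (g^[k] '' K) ε) :=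
    fun k => push_small K hK _ (hg.iterate k) ε hε
  choose δ hδ h using h1
  obtain ⟨δ', hδ', hle⟩ : ∃ δ' > 0, ∀ k ∈ Finset.range (n + 1), δ' ≤ δ k :=
    ⟨(Finset.range (n + 1)).inf' (by simp) δ, by simpa using fun k _ => hδ k,
      fun k hk => Finset.inf'_le _ hk⟩
  refine ⟨δ', hδ', fun c hc => ?_⟩
  have h2 : ∀ k ∈ Finset.range (n + 1),
      push g^[k] c ∈ Finsupp.supported R R (Sm (orb g n K) ε) := by
    intro k hk
    have := h k c (Finsupp.supported_mono (Sm_mono subset_rfl (hle k hk)) hc)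
    refine Finsupp.supported_mono (Sm_mono ?_ le_rfl) this
    exact Set.subset_biUnion_of_mem (u := fun k => g^[k] '' K) hk
  unfold Bop
  split_ifs
  · rw [Bn_apply]
    exact Submodule.sum_mem _ (fun k hk => h2 k (by simp at hk ⊢; omega))
  · rw [Bd_apply]
    refine Submodule.sub_mem _ (h2 1 (by simp; omega)) ?_
    have := h2 0 (by simp)
    simpa [push_id] using this

theorem chain_lemma (g : X → X) (hgc : Continuous g) (n : ℕ) (hn : 0 < n) (hg : g^[n] = id)
    (a N : ℕ) (D : ℕ → Set X) (hD : ∀ i < N, ∀ x ∈ D i, ∀ k, g^[k] x ∈ D (i + 1))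
    (H : ℕ → unitInterval × X → X) (q : ℕ → X)
    (hq : ∀ i < N, q i ∈ D (i + 1))
    (hHc : ∀ i < N, ContinuousOn (H i) (Set.univ ×ˢ D (i + 1)))
    (hHm : ∀ i < N, ∀ t, ∀ x ∈ D (i + 1), H i (t, x) ∈ D (i + 1))
    (hH0 : ∀ i < N, ∀ x ∈ D (i + 1), H i (0, x) = x)
    (hH1 : ∀ i < N, ∀ x ∈ D (i + 1), H i (1, x) = q i)
    (φ h : ℕ → (Ch R X →ₗ[R] R)) (hφ : ∀ i c, φ (i + 1) c = h i (bd c))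
    (Gd : R → Prop) (hG : ∀ i c, Gd (φ i c) → Gd (h i (Bop R g n (i + a) c)))
    (x0 : X) (hx0 : x0 ∈ D 0) (hb0 : bd (Bop R g n a (single [x0] 1)) = 0)
    (hG0 : Gd (φ 0 (single [x0] 1))) :
    ∀ i ≤ N, ∃ K : Set X, IsCompact K ∧ K ⊆ D i ∧ ∀ ε > 0,
      ∃ c ∈ Finsupp.supported R R (Sm K ε), bd (Bop R g n (i + a) c) = 0 ∧ Gd (φ i c) := by
  intro i
  induction i with
  | zero =>
    intro _
    refine ⟨{x0}, isCompact_singleton, by simpa using hx0, fun ε hε => ?_⟩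
    refine ⟨single [x0] 1, ?_, by simpa using hb0, hG0⟩
    apply Finsupp.single_mem_supported
    refine ⟨by simp, by simpa using hε⟩
  | succ i ih =>
    intro hi
    have hiN : i < N := by omega
    obtain ⟨K, hKc, hKD, hK⟩ := ih hiN.le
    have hoc := orb_compact g hgc n K hKc
    have hoD : orb g n K ⊆ D (i + 1) := by
      intro x hx
      simp only [orb, Set.mem_iUnion] at hx
      obtain ⟨k, _, y, hy, rfl⟩ := hx
      exact hD i hiN y (hKD hy) k
    have hcont : ContinuousOn (H i) (Set.univ ×ˢ orb g n K) :=
      (hHc i hiN).mono (Set.prod_mono subset_rfl hoD)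
    refine ⟨insert (q i) (H i '' (Set.univ ×ˢ orb g n K)), ?_, ?_, ?_⟩
    · exact ((isCompact_univ.prod hoc).image_of_continuousOn hcont).insert _
    · intro x hx
      rcases hx with rfl | ⟨⟨t, y⟩, ⟨_, hy⟩, rfl⟩
      · exact hq i hiN
      · exact hHm i hiN t y (hoD hy)
    · intro ε hε
      obtain ⟨δ, hδ, hfill⟩ := fill_lemma (R := R) (orb g n K) hoc (H i) (q i) hcont
        (fun x hx => hH0 i hiN x (hoD hx)) (fun x hx => hH1 i hiN x (hoD hx)) ε hε
      obtain ⟨δ', hδ', hB⟩ := Bop_small (R := R) K hKc g hgc n hn (i + a) δ hδ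
      obtain ⟨c, hc, hcb, hcG⟩ := hK δ' hδ'
      obtain ⟨d, hds, hdb⟩ := hfill _ (hB c hc) hcb
      refine ⟨d, hds, ?_, ?_⟩
      · rw [bd_Bop, hdb]
        have : i + 1 + a = (i + a) + 1 := by ring
        rw [this, Bop_Bop g n _ hg]
      · rw [hφ, hdb]
        exact hG i c hcG

end topo


section labels

theorem lab_ext {X : Type} (g : X → X) (n : ℕ) (hg : g^[n] = id)
    (lam : ℕ → X → ZMod n) (B : ℕ → Set X) (hB : ∀ j, ∀ x ∈ B j, g x ∈ B j)
    (hlam : ∀ j, ∀ x ∈ B j, lam j (g x) = lam j x + 1) (hcov : ∀ x, ∃ j, x ∈ B j) (hn : 0 < n) :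
    ∃ ℓ : ℕ → X → ZMod n, (∀ j x, ℓ j (g x) = ℓ j x + 1) ∧ ∀ j, ∀ x ∈ B j, ℓ j x = lam j x := by
  classical
  have hiter : ∀ j k, ∀ x ∈ B j, g^[k] x ∈ B j := by
    intro j k
    induction k with
    | zero => intro x hx; simpa using hx
    | succ k ih => intro x hx; rw [Function.iterate_succ_apply']; exact hB j _ (ih x hx)
  have hiff : ∀ j x, g x ∈ B j ↔ x ∈ B j := by
    intro j x
    refine ⟨fun h => ?_, hB j x⟩
    have h2 := hiter j (n - 1) _ h
    rw [← Function.iterate_succ_apply] at h2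
    have : (n - 1).succ = n := by omega
    rw [this, hg] at h2
    exact h2
  let j0 : X → ℕ := fun x => sInf {j | x ∈ B j}
  have hj0 : ∀ x, j0 (g x) = j0 x := by
    intro x; simp only [j0, hiff]
  have hj0m : ∀ x, x ∈ B (j0 x) := fun x => Nat.sInf_mem (s := {j | x ∈ B j}) (hcov x)
  refine ⟨fun j x => if x ∈ B j then lam j x else lam (j0 x) x, ?_, ?_⟩
  · intro j x
    simp only [hiff, hj0]
    split_ifs with h
    · exact hlam j x h
    · exact hlam _ x (hj0m x)
  · intro j x hx
    simp [hx]

theorem leb {X : Type} [MetricSpace X] {n : ℕ} (N : ℕ) (hN : 0 < N) (ℓ : ℕ → X → ZMod n)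
    (hloc : ∀ x, ∃ U : Set X, IsOpen U ∧ x ∈ U ∧ ∃ j < N, ∃ k, ∀ y ∈ U, ℓ j y = k)
    (K : Set X) (hK : IsCompact K) :
    ∃ ε > 0, ∀ l ∈ Sm K ε, ∃ j < N, CL (ℓ j) l := by
  obtain ⟨ε, hε, h⟩ := lebesgue_number_lemma_of_metric (s := K)
    (c := fun U : {U : Set X // IsOpen U ∧ ∃ j < N, ∃ k, ∀ y ∈ U, ℓ j y = k} => U.1) hK
    (fun U => U.2.1) (by
      intro x _
      obtain ⟨U, hU, hx, hj⟩ := hloc x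
      exact Set.mem_iUnion.2 ⟨⟨U, hU, hj⟩, hx⟩)
  refine ⟨ε, hε, fun l hl => ?_⟩
  cases l with
  | nil => exact ⟨0, hN, 0, by simp⟩
  | cons x t =>
    obtain ⟨⟨U, hU, j, hj, k, hk⟩, hb⟩ := h x (hl.1 x (by simp))
    refine ⟨j, hj, k, fun y hy => hk y (hb ?_)⟩
    rw [Metric.mem_ball]
    exact hl.2 y hy x (by simp)

end labels

section euclid

theorem fix_euclid (d p : ℕ) (hp : p.Prime) (g : EuclideanSpace ℝ (Fin d) → EuclideanSpace ℝ (Fin d))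
    (hgc : Continuous g) (hg : g^[p] = id) : ∃ x, g x = x := by
  classical
  by_contra! hfree
  have hFp : Fact p.Prime := ⟨hp⟩
  have hp0 : 0 < p := hp.pos
  let E := EuclideanSpace ℝ (Fin d)
  let co : ℕ → EuclideanSpace ℝ (Fin d) → ℝ := fun c x => if h : c < d then x ⟨c, h⟩ else 0
  have hco : ∀ c, Continuous (co c) := by
    intro c
    by_cases h : c < d
    · simp only [co, h, dif_pos]; fun_prop
    · simp only [co, h]; exact continuous_const
  let u : ℕ → E → ZMod p → ℝ := fun c x s => co c (g^[s.val] x)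
  have hu : ∀ c x s, u c (g x) s = u c x (s + 1) := by
    intro c x s
    simp only [u]
    congr 1
    have h1p : Fact (1 < p) := ⟨hp.one_lt⟩
    rw [← Function.iterate_succ_apply, ZMod.val_add, ZMod.val_one]
    have hper : Function.IsPeriodicPt g p x := by
      rw [Function.IsPeriodicPt, hg]; rfl
    exact (hper.iterate_mod_apply _).symm
  let A : ℕ → Finset (ZMod p) → Set E := fun c S => {x | ∀ s ∈ S, ∀ t ∉ S, u c x t < u c x s}
  have hAo : ∀ c S, IsOpen (A c S) := by
    intro c S
    have : A c S = ⋂ s : ZMod p, ⋂ t : ZMod p, {x | s ∈ S → t ∉ S → u c x t < u c x s} := by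
      ext x; simp only [A, Set.mem_ofPred_eq, Set.mem_iInter]
      exact ⟨fun h s t hs ht => h s hs t ht, fun h s hs t ht => h s t hs ht⟩
    rw [this]
    refine isOpen_iInter_of_finite fun s => isOpen_iInter_of_finite fun t => ?_
    by_cases hs : s ∈ S
    · by_cases ht : t ∈ S
      · simp [ht]
      · simp only [hs, ht, not_false_eq_true, forall_true_left]
        exact isOpen_lt ((hco c).comp (hgc.iterate _)) ((hco c).comp (hgc.iterate _))
    · simp [hs]
  have hAu : ∀ c S S' x, S.card = S'.card → x ∈ A c S → x ∈ A c S' → S = S' := by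
    intro c S S' x hc hS hS'
    by_cases hsub : S ⊆ S'
    · exact Finset.eq_of_subset_of_card_le hsub hc.ge
    · obtain ⟨s, hs, hs'⟩ := Finset.not_subset.1 hsub
      have : S' ⊆ S := by
        intro t ht
        by_contra htS
        exact lt_asymm (hS s hs t htS) (hS' t ht s hs')
      exact (Finset.eq_of_subset_of_card_le this hc.le).symm
  let sh : Finset (ZMod p) → Finset (ZMod p) := fun S => S.image (fun s => s - 1)
  have hsh : ∀ S s, s ∈ sh S ↔ s + 1 ∈ S := by
    intro S s
    simp only [sh, Finset.mem_image]
    constructor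
    · rintro ⟨t, ht, rfl⟩; simpa using ht
    · intro h; exact ⟨s + 1, h, by ring⟩
  have hshc : ∀ S, (sh S).card = S.card := fun S =>
    Finset.card_image_of_injective _ (sub_left_injective)
  have hshs : ∀ S, ∑ s ∈ sh S, s = ∑ s ∈ S, s - S.card := by
    intro S
    rw [Finset.sum_image (fun a _ b _ h => sub_left_injective h), Finset.sum_sub_distrib]
    simp
  have hAg : ∀ c S x, x ∈ A c S → g x ∈ A c (sh S) := by
    intro c S x hx s hs t ht
    rw [hu, hu]
    exact hx _ ((hsh S s).1 hs) _ (fun h => ht ((hsh S t).2 h))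
  let Q : ℕ → E → Finset (ZMod p) → Prop := fun j x S => S.card = j % p ∧ 0 < S.card ∧ x ∈ A (j / p) S
  let B : ℕ → Set E := fun j => {x | ∃ S, Q j x S}
  let lam : ℕ → E → ZMod p := fun j x =>
    if h : ∃ S, Q j x S then - ((∑ s ∈ h.choose, s) / (h.choose.card : ZMod p)) else 0
  have hlamv : ∀ j x S, Q j x S → lam j x = - ((∑ s ∈ S, s) / (S.card : ZMod p)) := by
    intro j x S hS
    have h : ∃ S, Q j x S := ⟨S, hS⟩
    have e : h.choose = S :=
      hAu _ _ _ x (h.choose_spec.1.trans hS.1.symm) h.choose_spec.2.2 hS.2.2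
    simp only [lam, dif_pos h, e]
  have hQg : ∀ j x S, Q j x S → Q j (g x) (sh S) := by
    intro j x S hS
    exact ⟨by rw [hshc]; exact hS.1, by rw [hshc]; exact hS.2.1, hAg _ _ _ hS.2.2⟩
  have hcov : ∀ x : E, ∃ j < d * p, x ∈ B j := by
    intro x
    obtain ⟨c, hc⟩ : ∃ c : Fin d, g x c ≠ x c := by
      by_contra! h
      exact hfree x (by ext c; exact h c)
    have hne : u c x 1 ≠ u c x 0 := by
      have h1 : u c x 0 = x c := by simp [u, co]
      have h2 : u c x 1 = g x c := by
        have := hu c x 0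
        rw [zero_add] at this
        rw [← this]; simp [u, co]
      rw [h1, h2]; exact hc
    let m := min (u c x 0) (u c x 1)
    let S : Finset (ZMod p) := Finset.univ.filter (fun s => m < u c x s)
    have hS : ∀ s, s ∈ S ↔ m < u c x s := by intro s; simp [S]
    have hpos : 0 < S.card := by
      rw [Finset.card_pos]
      rcases lt_or_gt_of_ne hne with h | h
      · exact ⟨0, (hS _).2 (by simp [m, h])⟩
      · exact ⟨1, (hS _).2 (by simp [m, h])⟩
    have hlt : S.card < p := by
      have : S ≠ Finset.univ := by
        intro h
        have h0 := (hS 0).1 (by rw [h]; simp)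
        have h1 := (hS 1).1 (by rw [h]; simp)
        exact lt_irrefl _ (lt_min h0 h1)
      have := (Finset.card_lt_iff_ne_univ S).2 this
      rwa [ZMod.card] at this
    refine ⟨c * p + S.card, ?_, S, ?_, hpos, ?_⟩
    · have := c.2
      calc c * p + S.card < c * p + p := by omega
        _ = (c + 1) * p := by ring
        _ ≤ d * p := Nat.mul_le_mul_right _ this
    · rw [mul_comm, Nat.mul_add_mod, Nat.mod_eq_of_lt hlt]
    · have : ((c : ℕ) * p + S.card) / p = c := by
        rw [mul_comm, Nat.mul_add_div hp0, Nat.div_eq_of_lt hlt, add_zero]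
      rw [this]
      intro s hs t ht
      have h1 := (hS s).1 hs
      have h2 : ¬ m < u c x t := fun h => ht ((hS t).2 h)
      linarith
  obtain ⟨ℓ, hℓ, hℓB⟩ := lab_ext g p hg lam B (fun j x ⟨S, hS⟩ => ⟨sh S, hQg j x S hS⟩)
    (by
      rintro j x ⟨S, hS⟩
      rw [hlamv j x S hS, hlamv j (g x) _ (hQg j x S hS), hshs, hshc]
      have : (S.card : ZMod p) ≠ 0 := by
        rw [Ne, ZMod.natCast_eq_zero_iff]
        intro h
        have := Nat.le_of_dvd hS.2.1 h
        have := hS.1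
        have := Nat.mod_lt j hp0
        omega
      field_simp
      ring)
    (fun x => (hcov x).imp fun j h => h.2) hp0
  obtain ⟨N', hN'⟩ : ∃ N', d * p = N' + 1 := by
    obtain ⟨j, hj, _⟩ := hcov 0
    exact ⟨d * p - 1, by omega⟩
  have hne : NeZero p := ⟨hp0.ne'⟩
  obtain ⟨h, h1, h2, h3⟩ := coch (R := ZMod p) g p hg ℓ hℓ
  let φ : ℕ → (Ch (ZMod p) E →ₗ[ZMod p] ZMod p) := fun i =>
    match i with
    | 0 => eps (ZMod p) E
    | i + 1 => h i ∘ₗ bd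
  obtain ⟨K, hKc, -, hK⟩ := chain_lemma (R := ZMod p) g hgc p hp0 hg 0 (N' + 1) (fun _ => Set.univ)
    (by simp) (fun _ z => (1 - (z.1 : ℝ)) • z.2) (fun _ => 0) (by simp)
    (fun _ _ => by apply Continuous.continuousOn; fun_prop) (by simp) (by simp) (by simp)
    φ h (fun i c => rfl) (fun r => r = 1)
    (by
      intro i c hc
      rw [add_zero]
      cases i with
      | zero => rw [h1]; exact hc
      | succ i => rw [h2]; exact hc)
    0 (by simp)
    (by
      rw [bd_Bop, bd_single]
      simp [Bop, Bn_apply, bdL])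
    (by simp [φ, eps_single]) (N' + 1) le_rfl
  obtain ⟨ε, hε, hsm⟩ := leb (N' + 1) (by omega) ℓ (by
    intro x
    obtain ⟨j, hj, S, hS⟩ := hcov x
    refine ⟨A (j / p) S, hAo _ _, hS.2.2, j, by omega, - ((∑ s ∈ S, s) / (S.card : ZMod p)), ?_⟩
    intro y hy
    have hQ : Q j y S := ⟨hS.1, hS.2.1, hy⟩
    rw [hℓB j y ⟨S, hQ⟩, hlamv j y S hQ]) K hKc
  obtain ⟨c, hc, -, hc1⟩ := hK ε hε
  have := lin_mem (φ (N' + 1)) _ ⊥ (by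
    intro l hl
    obtain ⟨j, hj, hCL⟩ := hsm l hl
    exact h3 N' j (by omega) l hCL) hc
  rw [Submodule.mem_bot, hc1] at this
  exact one_ne_zero this

end euclid


section sphere

abbrev E5 := EuclideanSpace ℝ (Fin 5)
abbrev X5 := {x : E5 // x ≠ 0}

noncomputable def co (c : ℕ) (x : E5) : ℝ := if h : c < 5 then x ⟨c, h⟩ else 0

theorem co_cont (c : ℕ) : Continuous (co c) := by
  by_cases h : c < 5
  · have : co c = fun x => x ⟨c, h⟩ := by ext x; simp [co, h]
    rw [this]; fun_prop
  · have : co c = fun _ => 0 := by ext x; simp [co, h]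
    rw [this]; exact continuous_const

theorem co_comb (c : ℕ) (a b : ℝ) (x y : E5) : co c (a • x + b • y) = a * co c x + b * co c y := by
  by_cases h : c < 5 <;> simp [co, h]

theorem co_neg (c : ℕ) (x : E5) : co c (-x) = - co c x := by
  by_cases h : c < 5 <;> simp [co, h]

theorem co_ne (x : E5) (hx : x ≠ 0) : ∃ c < 5, co c x ≠ 0 := by
  by_contra! h
  apply hx
  ext c
  have := h c c.2
  simpa [co] using this

noncomputable def ev (c : ℕ) : E5 := if h : c < 5 then EuclideanSpace.single ⟨c, h⟩ 1 else EuclideanSpace.single 0 1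

theorem co_ev (c : ℕ) (hc : c < 5) (j : ℕ) : co j (ev c) = if j = c then 1 else 0 := by
  by_cases h : j < 5
  · simp [co, ev, h, hc]
  · have : j ≠ c := by omega
    simp [co, h, this]

theorem ev_ne (c : ℕ) : ev c ≠ 0 := by
  unfold ev; split_ifs <;> simp

noncomputable def ng (x : X5) : X5 := ⟨-x.1, neg_ne_zero.2 x.2⟩

theorem ng_ng (x : X5) : ng (ng x) = x := by simp [ng]

noncomputable def HH (i : ℕ) (z : unitInterval × X5) : X5 :=
  open Classical in
  if h : (1 - (z.1 : ℝ)) • z.2.1 + (z.1 : ℝ) • ev (i + 1) ≠ 0 then ⟨_, h⟩ else z.2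

def DD (i : ℕ) : Set X5 := {x | (∀ j > i, co j x.1 = 0) ∧ 0 ≤ co i x.1}

theorem HH_ne (i : ℕ) (hi : i < 4) (t : unitInterval) (x : X5) (hx : x ∈ DD (i + 1)) :
    (1 - (t : ℝ)) • x.1 + (t : ℝ) • ev (i + 1) ≠ 0 := by
  intro h
  have h1 := congrArg (co (i + 1)) h
  have h0 : co (i + 1) 0 = 0 := by simp [co]
  rw [co_comb, co_ev _ (by omega), if_pos rfl, h0] at h1
  have ht0 := t.2.1
  have ht1 := t.2.2
  have h2 : 0 ≤ (1 - (t : ℝ)) * co (i + 1) x.1 := mul_nonneg (by linarith) hx.2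
  have h3 : (t : ℝ) = 0 := by linarith
  rw [h3] at h
  simp at h
  exact x.2 h

theorem HH_val (i : ℕ) (hi : i < 4) (t : unitInterval) (x : X5) (hx : x ∈ DD (i + 1)) :
    (HH i (t, x)).1 = (1 - (t : ℝ)) • x.1 + (t : ℝ) • ev (i + 1) := by
  rw [HH, dif_pos (HH_ne i hi t x hx)]

theorem no_hom (H : unitInterval × X5 → X5) (hH : Continuous H) (h0 : ∀ x, H (0, x) = x)
    (h1 : ∀ x, H (1, x) = ng x) : False := by
  classical
  have hng : Continuous ng := by unfold ng; fun_prop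
  have hg2 : ng^[2] = id := by ext1 x; simp [ng_ng]
  let B : ℕ → Set X5 := fun j => {x | co j x.1 ≠ 0}
  let lam : ℕ → X5 → ZMod 2 := fun j x => if 0 < co j x.1 then 0 else 1
  have hcong : ∀ j x, co j (ng x).1 = - co j x.1 := fun j x => co_neg j x.1
  obtain ⟨ℓ, hℓ, hℓB⟩ := lab_ext ng 2 hg2 lam B
    (by intro j x hx; simp only [B, Set.mem_ofPred_eq, hcong] at hx ⊢; simpa using hx)
    (by
      intro j x hx
      simp only [B, Set.mem_ofPred_eq] at hx
      simp only [lam, hcong]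
      rcases lt_or_gt_of_ne hx with h | h
      · rw [if_pos (by linarith), if_neg (by linarith)]; decide
      · rw [if_neg (by linarith), if_pos (by linarith)]; decide)
    (fun x => (co_ne x.1 x.2).imp fun j h => h.2) (by norm_num)
  obtain ⟨h, c1, c2, c3⟩ := coch (R := ℤ) ng 2 hg2 ℓ hℓ
  let φ : ℕ → (Ch ℤ X5 →ₗ[ℤ] ℤ) := fun i =>
    match i with
    | 0 => eps ℤ X5
    | i + 1 => h i ∘ₗ bd
  have hφ : ∀ i c, h i (Bop ℤ ng 2 i c) = φ i c := by
    intro i c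
    cases i with
    | zero => rw [c1]
    | succ i => rw [c2]; rfl
  have hBnd : ∀ c, Bn ℤ ng 2 c = Bd ℤ ng c + (2 : ℤ) • c := by
    intro c
    rw [Bn_apply, Bd_apply, Finset.sum_range_succ, Finset.sum_range_one]
    simp only [Function.iterate_zero, Function.iterate_one, push_id]
    rw [two_smul]; abel
  have hodd : ∀ i c, Odd (φ i c) → Odd (h i (Bop ℤ ng 2 (i + 1) c)) := by
    intro i c hc
    rw [← hφ] at hc
    unfold Bop at hc ⊢
    by_cases he : Even i
    · have he' : ¬ Even (i + 1) := by simpa [Nat.even_add_one] using he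
      rw [if_pos he, hBnd, map_add, map_smul, smul_eq_mul] at hc
      rw [if_neg he']
      rw [Int.odd_add] at hc
      exact hc.2 (even_two_mul _)
    · have he' : Even (i + 1) := by simpa [Nat.even_add_one] using he
      rw [if_neg he] at hc
      rw [if_pos he', hBnd, map_add, map_smul, smul_eq_mul]
      exact hc.add_even (even_two_mul _)
  have hitn : ∀ k j x, co j x = 0 → ∀ y : X5, y.1 = x → co j (ng^[k] y).1 = 0 := by
    intro k j x hx y hy
    induction k with
    | zero => simpa [hy] using hx
    | succ k ih => rw [Function.iterate_succ_apply', hcong, ih, neg_zero]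
  obtain ⟨K, hKc, -, hK⟩ := chain_lemma (R := ℤ) ng hng 2 (by norm_num) hg2 1 4 DD
    (by
      intro i hi x hx k
      refine ⟨fun j hj => ?_, le_of_eq ?_⟩
      · exact hitn k j x.1 (hx.1 j (by omega)) x rfl
      · exact (hitn k (i + 1) x.1 (hx.1 _ (by omega)) x rfl).symm)
    HH (fun i => ⟨ev (i + 1), ev_ne _⟩)
    (by
      intro i hi
      refine ⟨fun j hj => ?_, ?_⟩
      · simp only; rw [co_ev _ (by omega), if_neg (by omega)]
      · simp only; rw [co_ev _ (by omega), if_pos rfl]; norm_num)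
    (by
      intro i hi
      have hind : Topology.IsInducing (Subtype.val : X5 → E5) := ⟨rfl⟩
      rw [hind.continuousOn_iff]
      have : ContinuousOn (fun z : unitInterval × X5 =>
          (1 - (z.1 : ℝ)) • z.2.1 + (z.1 : ℝ) • ev (i + 1)) (Set.univ ×ˢ DD (i + 1)) := by
        apply Continuous.continuousOn; fun_prop
      refine this.congr ?_
      rintro ⟨t, x⟩ ⟨_, hx⟩
      exact HH_val i hi t x hx)
    (by
      intro i hi t x hx
      refine ⟨fun j hj => ?_, ?_⟩
      · rw [HH_val i hi t x hx, co_comb, co_ev _ (by omega), if_neg (by omega), hx.1 j hj]; ring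
      · rw [HH_val i hi t x hx, co_comb, co_ev _ (by omega), if_pos rfl]
        have ht0 := t.2.1
        have ht1 := t.2.2
        have h2 : 0 ≤ (1 - (t : ℝ)) * co (i + 1) x.1 := mul_nonneg (by linarith) hx.2
        linarith)
    (by
      intro i hi x hx
      apply Subtype.ext
      rw [HH_val i hi 0 x hx]; simp)
    (by
      intro i hi x hx
      apply Subtype.ext
      rw [HH_val i hi 1 x hx]; simp)
    φ h (fun i c => rfl) (fun r => Odd r) hodd ⟨ev 0, ev_ne 0⟩
    (by
      refine ⟨fun j hj => ?_, ?_⟩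
      · simp only; rw [co_ev _ (by omega), if_neg (by omega)]
      · simp only; rw [co_ev _ (by omega), if_pos rfl]; norm_num)
    (by
      rw [bd_Bop, bd_single]
      simp [Bop, Bd_apply, bdL])
    (by simp [φ, eps_single]) 4 le_rfl
  have hoc := orb_compact ng hng 2 K hKc
  obtain ⟨ε, hε, hsm⟩ := leb 5 (by omega) ℓ (by
    intro x
    obtain ⟨j, hj, hx⟩ := co_ne x.1 x.2
    rcases lt_or_gt_of_ne hx with hlt | hlt
    · refine ⟨{y | co j y.1 < 0}, ?_, hlt, j, hj, 1, ?_⟩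
      · exact isOpen_lt ((co_cont j).comp continuous_subtype_val) continuous_const
      · intro y hy
        have hy' : co j y.1 < 0 := hy
        rw [hℓB j y hy'.ne]
        simp only [lam]; rw [if_neg (by linarith)]
    · refine ⟨{y | 0 < co j y.1}, ?_, hlt, j, hj, 0, ?_⟩
      · exact isOpen_lt continuous_const ((co_cont j).comp continuous_subtype_val)
      · intro y hy
        have hy' : 0 < co j y.1 := hy
        rw [hℓB j y hy'.ne']
        simp only [lam]; rw [if_pos hy'])
    (H '' (Set.univ ×ˢ orb ng 2 K)) ((isCompact_univ.prod hoc).image hH)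
  obtain ⟨δ, hδ, hhom⟩ := hom_lemma (R := ℤ) (orb ng 2 K) hoc H hH.continuousOn ε hε
  obtain ⟨δ', hδ', hB⟩ := Bop_small (R := ℤ) K hKc ng hng 2 (by norm_num) (4 + 1) δ hδ
  obtain ⟨c, hc, hcb, hcG⟩ := hK δ' hδ'
  obtain ⟨d, hds, hdb⟩ := hhom _ (hB c hc) hcb
  have hz := hodd 4 c hcG
  have e1 : (fun x => H (1, x)) = ng := funext h1
  have e0 : (fun x => H (0, x)) = id := funext h0
  rw [e1, e0, push_id] at hdb
  have e2 : push ng (Bop ℤ ng 2 (4 + 1) c) = - Bop ℤ ng 2 (4 + 1) c := by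
    have : ¬ Even (4 + 1) := by decide
    rw [Bop, if_neg this, Bd_apply, map_sub, push_push]
    have : ng ∘ ng = id := hg2
    rw [this, push_id]; abel
  rw [e2] at hdb
  have hv := lin_mem (h 4 ∘ₗ bd) _ ⊥ (by
    intro l hl
    obtain ⟨j, hj, hCL⟩ := hsm l hl
    exact c3 4 j (by omega) l hCL) hds
  rw [Submodule.mem_bot, LinearMap.comp_apply, hdb, map_sub, map_neg] at hv
  have : h 4 (Bop ℤ ng 2 (4 + 1) c) = 0 := by linarith
  rw [this] at hz
  exact absurd hz (by decide)

end sphere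


section final

abbrev SS := Metric.sphere (0 : E5) 1

theorem no_free (p : ℕ) (hodd : Odd p) (f : SS → SS) (hf : Continuous f) (hfp : f^[p] = id) :
    ∃ x, f x = x := by
  by_contra! hfree
  let nS : SS → SS := fun x => -x
  have hnS : Continuous nS := by
    refine Continuous.subtype_mk (f := fun x : SS => -x.1) ?_ _
    fun_prop
  have hne : ∀ (t : unitInterval) (x : SS), (1 - (t : ℝ)) • (f x).1 + (t : ℝ) • (-x.1) ≠ 0 := by
    intro t x h
    have ht0 := t.2.1
    have ht1 := t.2.2
    have hx : ‖x.1‖ = 1 := by simp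
    have hfx : ‖(f x).1‖ = 1 := by simp
    have h1 : (1 - (t : ℝ)) • (f x).1 = (t : ℝ) • x.1 := by
      rw [smul_neg, ← sub_eq_add_neg, sub_eq_zero] at h; exact h
    have h2 := congrArg norm h1
    rw [norm_smul, norm_smul, hx, hfx, Real.norm_of_nonneg (by linarith),
      Real.norm_of_nonneg ht0] at h2
    have h3 : (t : ℝ) = 1 / 2 := by linarith
    rw [h3] at h1
    have h4 : (1 - 1 / 2 : ℝ) = 1 / 2 := by norm_num
    rw [h4] at h1
    have h5 := smul_right_injective E5 (by norm_num : (1 / 2 : ℝ) ≠ 0) h1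
    exact hfree x (Subtype.ext h5)
  let F : C(SS, SS) := ⟨f, hf⟩
  let G : C(SS, SS) := ⟨nS, hnS⟩
  have hFG : F.Homotopic G := by
    let V : unitInterval × SS → E5 := fun z => (1 - (z.1 : ℝ)) • (f z.2).1 + (z.1 : ℝ) • (-z.2.1)
    have hV : Continuous V := by fun_prop
    have hV0 : ∀ z, ‖V z‖ ≠ 0 := fun z => norm_ne_zero_iff.2 (hne z.1 z.2)
    refine ⟨⟨⟨fun z => ⟨(‖V z‖)⁻¹ • V z, ?_⟩, ?_⟩, ?_, ?_⟩⟩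
    · simp [norm_smul, hV0 z]
    · refine Continuous.subtype_mk ?_ _
      exact (hV.norm.inv₀ hV0).smul hV
    · intro x
      apply Subtype.ext
      simp [V, F]
    · intro x
      apply Subtype.ext
      simp [V, G, nS]
  have hit : ∀ k, (⟨f^[k], hf.iterate k⟩ : C(SS, SS)).Homotopic ⟨nS^[k], hnS.iterate k⟩ := by
    intro k
    induction k with
    | zero => exact ContinuousMap.Homotopic.refl _
    | succ k ih =>
      have := ih.comp hFG
      exact this
  have hnn : nS^[2] = id := by ext1 x; simp [nS]
  have hnp : nS^[p] = nS := by
    obtain ⟨m, rfl⟩ := hodd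
    rw [Function.iterate_add, Function.iterate_mul, hnn]; simp
  obtain ⟨HT⟩ := hit p
  have hT0 : ∀ x, HT (0, x) = x := by
    intro x; rw [HT.apply_zero]; simp [hfp]
  have hT1 : ∀ x, HT (1, x) = -x := by
    intro x; rw [HT.apply_one]; simp [hnp, nS]
  have hx0 : ∀ x : X5, ‖x.1‖ ≠ 0 := fun x => norm_ne_zero_iff.2 x.2
  let nu : X5 → SS := fun x => ⟨(‖x.1‖)⁻¹ • x.1, by simp [norm_smul, hx0 x]⟩
  have hnu : Continuous nu := by
    refine Continuous.subtype_mk ?_ _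
    exact ((continuous_subtype_val.norm).inv₀ hx0).smul continuous_subtype_val
  have hval : ∀ x : X5, ‖x.1‖ • (nu x).1 = x.1 := by
    intro x
    simp only [nu, smul_smul]
    rw [mul_inv_cancel₀ (hx0 x), one_smul]
  refine no_hom (fun z => ⟨‖z.2.1‖ • (HT (z.1, nu z.2)).1, ?_⟩) ?_ ?_ ?_
  · refine smul_ne_zero (hx0 _) ?_
    exact ne_zero_of_mem_unit_sphere _
  · refine Continuous.subtype_mk ?_ _
    have h1 : Continuous (fun z : unitInterval × X5 => HT (z.1, nu z.2)) :=
      HT.continuous.comp (continuous_fst.prodMk (hnu.comp continuous_snd))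
    exact (continuous_subtype_val.comp continuous_snd).norm.smul (continuous_subtype_val.comp h1)
  · intro x
    apply Subtype.ext
    simp only [hT0]
    exact hval x
  · intro x
    apply Subtype.ext
    simp only [hT1, ng]
    rw [← hval x]
    simp [norm_smul]

theorem two_fix (p : ℕ) (hp : p.Prime) (f : SS ≃ₜ SS) (hfp : (⇑f)^[p] = id) (q : SS)
    (hq : f q = q) : ∃ x, q ≠ x ∧ f x = x := by
  have hfact : Fact (Module.finrank ℝ E5 = 4 + 1) := ⟨by simp⟩
  let st := stereographic' 4 q
  have hs : st.source = {q}ᶜ := stereographic'_source q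
  have ht : st.target = Set.univ := stereographic'_target q
  have hsym : ∀ y, st.symm y ≠ q := by
    intro y
    have := st.map_target (x := y) (by rw [ht]; trivial)
    rw [hs] at this
    exact this
  have hfs : ∀ x, x ≠ q → f x ≠ q := by
    intro x hx h
    exact hx (f.injective (h.trans hq.symm))
  have hl : ∀ x, x ≠ q → st.symm (st x) = x := fun x hx => st.left_inv (by rw [hs]; exact hx)
  have hr : ∀ y, st (st.symm y) = y := fun y => st.right_inv (by rw [ht]; trivial)
  have hsc : Continuous st.symm := by
    rw [← continuousOn_univ, ← ht]; exact st.continuousOn_symm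
  let g : EuclideanSpace ℝ (Fin 4) → EuclideanSpace ℝ (Fin 4) := fun y => st (f (st.symm y))
  have hgc : Continuous g := by
    rw [← continuousOn_univ]
    refine st.continuousOn.comp (f.continuous.comp hsc).continuousOn ?_
    intro y _
    rw [hs]
    exact hfs _ (hsym y)
  have hit : ∀ k y, st.symm (g^[k] y) = f^[k] (st.symm y) := by
    intro k y
    induction k with
    | zero => rfl
    | succ k ih =>
      rw [Function.iterate_succ_apply', Function.iterate_succ_apply', ← ih]
      exact hl _ (hfs _ (hsym _))
  have hg : g^[p] = id := by
    ext1 y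
    have := congrArg st (hit p y)
    rw [hr, hfp] at this
    rw [this]; exact hr y
  obtain ⟨y, hy⟩ := fix_euclid 4 p hp g hgc hg
  refine ⟨st.symm y, (hsym y).symm, ?_⟩
  have := hit 1 y
  simp only [Function.iterate_one] at this
  rw [← this, hy]

end final

end SmithS4



/-- A homeomorphism of `S⁴` of odd prime order `p` has at least two fixed points. -/
theorem homeomorph_S4_odd_prime_order_has_two_fixed_points
    (p : ℕ) (hp : p.Prime) (hodd : Odd p)
    (f : S4 ≃ₜ S4) (hfp : (⇑f)^[p] = id) (hne : ⇑f ≠ id) :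
    ∃ x y : S4, x ≠ y ∧ f x = x ∧ f y = y := by
  obtain ⟨q, hq⟩ := SmithS4.no_free p hodd f f.continuous hfp
  obtain ⟨x, hx, hfx⟩ := SmithS4.two_fix p hp f hfp q hq
  exact ⟨q, x, hx, hq, hfx⟩
end

section
/- Let p be a prime and let G be a finite p-group acting continuously on the 4-sphere S^4 (each element acting as a homeomorphism). If the action has at least one global fixed point, then it has at least two global fixed points; equivalently, the global fixed point set of a continuous p-group action on S^4 is never a single point. -/
namespace Smith

section Cochains

variable {P : Type*} {R : Type*} [CommRing R]

/-- Coboundary of a function on lists (augmented, ordered cochains). -/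
def dl : (List P → R) → List P → R
  | _, [] => 0
  | f, a :: l => f l - dl (fun l' => f (a :: l')) l

/-- Normalized cochains: they vanish on lists with an adjacent repetition. -/
def Nm (f : List P → R) : Prop := ∀ l₁ a l₂, f (l₁ ++ a :: a :: l₂) = 0

theorem dl_congr (l : List P) : ∀ (f f' : List P → R),
    (∀ l', l'.Sublist l → f l' = f' l') → dl f l = dl f' l := by
  induction l with
  | nil => intros; rfl
  | cons a l ih =>
    intro f f' h
    simp only [dl]
    rw [h l (List.sublist_cons_self a l), ih _ _ (fun l' hl' => h _ (hl'.cons_cons a))]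

theorem dl_zero (l : List P) : dl (fun _ => (0 : R)) l = 0 := by
  induction l with
  | nil => rfl
  | cons a l ih => simp [dl, ih]

theorem dl_sub (l : List P) : ∀ (f f' : List P → R),
    dl (fun l => f l - f' l) l = dl f l - dl f' l := by
  induction l with
  | nil => intros; simp [dl]
  | cons a l ih => intro f f'; simp only [dl]; rw [ih]; ring

theorem dl_add (l : List P) : ∀ (f f' : List P → R),
    dl (fun l => f l + f' l) l = dl f l + dl f' l := by
  induction l with
  | nil => intros; simp [dl]
  | cons a l ih => intro f f'; simp only [dl]; rw [ih]; ring

theorem dl_sum {ι : Type*} (s : Finset ι) (F : ι → List P → R) (l : List P) :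
    dl (fun l => ∑ i ∈ s, F i l) l = ∑ i ∈ s, dl (F i) l := by
  classical
  induction s using Finset.induction_on with
  | empty => simp [dl_zero]
  | insert a s ha ih => simp only [Finset.sum_insert ha]; rw [dl_add, ih]

theorem dl_dl (l : List P) : ∀ (f : List P → R), dl (dl f) l = 0 := by
  induction l with
  | nil => intros; rfl
  | cons a l ih =>
    intro f
    simp only [dl]
    rw [dl_sub, ih]; ring

theorem dl_map (φ : P → P) (l : List P) : ∀ (f : List P → R),
    dl (fun l => f (l.map φ)) l = dl f (l.map φ) := by
  induction l with
  | nil => intros; rfl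
  | cons a l ih =>
    intro f
    simp only [dl, List.map_cons]
    rw [← ih]

theorem Nm.cons {f : List P → R} (h : Nm f) (a : P) : Nm (fun l => f (a :: l)) :=
  fun l₁ b l₂ => h (a :: l₁) b l₂

theorem Nm.dl {f : List P → R} (h : Nm f) : Nm (dl f) := by
  intro l₁
  induction l₁ generalizing f with
  | nil =>
    intro a l₂
    have h0 : (fun l => f (a :: a :: l)) = fun _ => 0 := by
      funext l; exact h [] a l
    simp only [List.nil_append, Smith.dl]
    rw [h0, dl_zero]; ring
  | cons b l₁ ih =>
    intro a l₂
    simp only [List.cons_append, Smith.dl]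
    rw [h, ih (h.cons b)]; ring

theorem Nm.map {f : List P → R} (h : Nm f) (φ : P → P) : Nm (fun l => f (l.map φ)) := by
  intro l₁ a l₂
  simp only [List.map_append, List.map_cons]
  exact h _ _ _

theorem Nm.sub {f f' : List P → R} (h : Nm f) (h' : Nm f') : Nm (fun l => f l - f' l) := by
  intro l₁ a l₂; simp only [h l₁ a l₂, h' l₁ a l₂, sub_zero]

theorem Nm.add {f f' : List P → R} (h : Nm f) (h' : Nm f') : Nm (fun l => f l + f' l) := by
  intro l₁ a l₂; simp only [h l₁ a l₂, h' l₁ a l₂, add_zero]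

/-- Prism operator. -/
def hm (α β : P → P) : (List P → R) → List P → R
  | _, [] => 0
  | f, a :: l => f (α a :: β a :: l.map β) - hm α β (fun l' => f (α a :: l')) l

theorem hm_zero (α β : P → P) (l : List P) : hm α β (fun _ => (0 : R)) l = 0 := by
  induction l with
  | nil => rfl
  | cons a l ih => simp [hm, ih]

theorem hm_sub (α β : P → P) (l : List P) : ∀ (f f' : List P → R),
    hm α β (fun l => f l - f' l) l = hm α β f l - hm α β f' l := by
  induction l with
  | nil => intros; simp [hm]
  | cons a l ih => intro f f'; simp only [hm]; rw [ih]; ring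

theorem hm_add (α β : P → P) (l : List P) : ∀ (f f' : List P → R),
    hm α β (fun l => f l + f' l) l = hm α β f l + hm α β f' l := by
  induction l with
  | nil => intros; simp [hm]
  | cons a l ih => intro f f'; simp only [hm]; rw [ih]; ring

theorem hm_sum (α β : P → P) {ι : Type*} (s : Finset ι) (F : ι → List P → R) (l : List P) :
    hm α β (fun l => ∑ i ∈ s, F i l) l = ∑ i ∈ s, hm α β (F i) l := by
  classical
  induction s using Finset.induction_on with
  | empty => simp [hm_zero]
  | insert a s ha ih => simp only [Finset.sum_insert ha]; rw [hm_add, ih]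

theorem hm_map (α β φ : P → P) (hα : ∀ a, φ (α a) = α (φ a)) (hβ : ∀ a, φ (β a) = β (φ a))
    (l : List P) : ∀ (f : List P → R),
    hm α β (fun l => f (l.map φ)) l = hm α β f (l.map φ) := by
  induction l with
  | nil => intros; rfl
  | cons a l ih =>
    intro f
    simp only [hm, List.map_cons]
    rw [← hα, ← hβ, ← ih]
    simp [Function.comp_def, hβ]

theorem Nm.hm {f : List P → R} (h : Nm f) (α β : P → P) : Nm (hm α β f) := by
  intro l₁
  induction l₁ generalizing f with
  | nil =>
    intro a l₂
    have h0 : (fun l => f (α a :: α a :: l)) = fun _ => 0 := by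
      funext l; exact h [] _ l
    simp only [List.nil_append, Smith.hm, List.map_cons]
    have h1 := h [] (α a) (β a :: l₂.map β)
    have h2 := h [α a] (β a) (l₂.map β)
    simp only [List.nil_append, List.cons_append] at h1 h2
    rw [h0, hm_zero, h1, h2]; ring
  | cons b l₁ ih =>
    intro a l₂
    simp only [List.cons_append, Smith.hm]
    rw [ih (h.cons _)]
    have := h (α b :: β b :: l₁.map β) (β a) (l₂.map β)
    simp only [List.map_append, List.map_cons, List.cons_append] at this ⊢
    rw [this]; ring

theorem hm_identity (α β : P → P) (l : List P) : ∀ f : List P → R,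
    dl (hm α β f) l + hm α β (dl f) l = f (l.map β) - f (l.map α) := by
  induction l with
  | nil => intro f; simp [dl, hm]
  | cons a l ih =>
    intro f
    have e3 : dl (fun l' => f (α a :: β a :: l'.map β)) l
      = dl (fun l' => f (α a :: β a :: l')) (l.map β) :=
        dl_map β l (fun l' => f (α a :: β a :: l'))
    have := ih (fun l' => f (α a :: l'))
    simp only [dl, hm, List.map_cons]
    rw [dl_sub, hm_sub, e3]
    linear_combination this

variable [Preorder P]

/-- Weakly increasing lists of elements satisfying `D`. -/
def K (D : P → Prop) : Set (List P) := {l | (∀ a ∈ l, D a) ∧ l.Pairwise (· ≤ ·)}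

theorem K_sublist {D : P → Prop} {l l' : List P} (h : l ∈ K D) (hl : l'.Sublist l) : l' ∈ K D :=
  ⟨fun a ha => h.1 a (hl.subset ha), h.2.sublist hl⟩

theorem K_mono {D D' : P → Prop} (h : ∀ a, D a → D' a) {l : List P} (hl : l ∈ K D) : l ∈ K D' :=
  ⟨fun a ha => h a (hl.1 a ha), hl.2⟩

theorem K_map {D D' : P → Prop} {φ : P → P} (hφ : Monotone φ) (h : ∀ a, D a → D' (φ a))
    {l : List P} (hl : l ∈ K D) : l.map φ ∈ K D' := by
  refine ⟨?_, ?_⟩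
  · intro a ha
    obtain ⟨b, hb, rfl⟩ := List.mem_map.1 ha
    exact h b (hl.1 b hb)
  · rw [List.pairwise_map]
    exact hl.2.imp (fun h => hφ h)

theorem dl_congr_K {D : P → Prop} {f f' : List P → R} (h : ∀ l ∈ K D, f l = f' l)
    {l : List P} (hl : l ∈ K D) : dl f l = dl f' l :=
  dl_congr l f f' (fun _ hl' => h _ (K_sublist hl hl'))

theorem hm_vanish {D D' : P → Prop} {α β : P → P} (hα : Monotone α) (hβ : Monotone β)
    (hαβ : ∀ a, α a ≤ β a) (hDα : ∀ a, D a → D' (α a)) (hDβ : ∀ a, D a → D' (β a))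
    (l : List P) (hl : l ∈ K D) : ∀ f : List P → R,
    (∀ l' ∈ K D', (∀ x ∈ l', ∃ a ∈ l, α a ≤ x) → f l' = 0) → hm α β f l = 0 := by
  induction l with
  | nil => intros; rfl
  | cons a l ih =>
    intro f hf
    have hl' : l ∈ K D := K_sublist hl (List.sublist_cons_self a l)
    have hal : ∀ b ∈ l, a ≤ b := (List.pairwise_cons.1 hl.2).1
    have hDa : D a := hl.1 a (by simp)
    simp only [hm]
    rw [hf, ih hl', sub_zero]
    · intro l' h1 h2
      refine hf _ ⟨?_, ?_⟩ ?_
      · intro x hx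
        rcases List.mem_cons.1 hx with rfl | hx
        · exact hDα _ hDa
        · exact h1.1 x hx
      · refine List.pairwise_cons.2 ⟨?_, h1.2⟩
        intro x hx
        obtain ⟨b, hb, hbx⟩ := h2 x hx
        exact (hα (hal b hb)).trans hbx
      · intro x hx
        rcases List.mem_cons.1 hx with rfl | hx
        · exact ⟨a, by simp, le_rfl⟩
        · obtain ⟨b, hb, hbx⟩ := h2 x hx
          exact ⟨b, by simp [hb], hbx⟩
    · have hm1 := K_map hβ hDβ hl
      refine ⟨?_, ?_⟩
      · intro x hx
        rcases List.mem_cons.1 hx with rfl | hx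
        · exact hDα _ hDa
        · exact hm1.1 x hx
      · refine List.pairwise_cons.2 ⟨?_, hm1.2⟩
        intro x hx
        rw [← List.map_cons] at hx
        obtain ⟨b, hb, rfl⟩ := List.mem_map.1 hx
        rcases List.mem_cons.1 hb with rfl | hb
        · exact hαβ _
        · exact (hαβ a).trans (hβ (hal b hb))
    · intro x hx
      rcases List.mem_cons.1 hx with rfl | hx
      · exact ⟨a, by simp, le_rfl⟩
      · rw [← List.map_cons] at hx
        obtain ⟨b, hb, rfl⟩ := List.mem_map.1 hx
        exact ⟨b, hb, hαβ b⟩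

/-- Comparable maps induce cohomologous pullbacks. -/
theorem homotopy {D D' : P → Prop} {α β : P → P} (hα : Monotone α) (hβ : Monotone β)
    (hαβ : ∀ a, α a ≤ β a) (hDα : ∀ a, D a → D' (α a)) (hDβ : ∀ a, D a → D' (β a))
    (f : List P → R) (hf : ∀ l ∈ K D', dl f l = 0) (l : List P) (hl : l ∈ K D) :
    f (l.map β) - f (l.map α) = dl (hm α β f) l := by
  rw [← hm_identity, hm_vanish hα hβ hαβ hDα hDβ l hl (dl f) (fun l' h _ => hf l' h), add_zero]

/-- Cocycles on `K D` become coboundaries on `K D'`. -/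
def Triv (R : Type*) [CommRing R] (D D' : P → Prop) : Prop :=
  ∀ f : List P → R, Nm f → (∀ l ∈ K D, dl f l = 0) → ∃ w, Nm w ∧ ∀ l ∈ K D', f l = dl w l

end Cochains

section Orbit

theorem exists_orbit_fun {X : Type*} (γ : X → X) (p : ℕ) [hp : Fact p.Prime] :
    ∃ e : X → ZMod p, (∀ x, γ x = x → e x = 0) ∧
      ∀ x, γ^[p] x = x → γ x ≠ x → ∑ j ∈ Finset.range p, e (γ^[j] x) = 1 := by
  classical
  let O : X → Set X := fun x => Set.range (fun j : ℕ => γ^[j] x)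
  have hne : ∀ x, (O x).Nonempty := fun x => ⟨x, 0, rfl⟩
  let c : X → X := fun x => (hne x).some
  have hc : ∀ x, c x ∈ O x := fun x => (hne x).some_mem
  have hcc : ∀ x y, O x = O y → c x = c y := by
    intro x y h
    simp only [c]; congr 1
  refine ⟨fun x => if γ x ≠ x ∧ c x = x then 1 else 0, fun x hx => by simp [hx], ?_⟩
  intro x hx hx1
  have hp0 := hp.1.pos
  have hper : Function.IsPeriodicPt γ p x := hx
  have hmp : Function.minimalPeriod γ x = p := by
    rcases (Nat.dvd_prime hp.1).1 hper.minimalPeriod_dvd with h | h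
    · exact absurd (Function.minimalPeriod_eq_one_iff_isFixedPt.1 h) hx1
    · exact h
  have hO : ∀ j, O (γ^[j] x) = O x := by
    intro j
    apply Set.Subset.antisymm
    · rintro _ ⟨i, rfl⟩
      exact ⟨i + j, by simp only [Function.iterate_add_apply]⟩
    · rintro _ ⟨i, rfl⟩
      refine ⟨i + (p * j - j), ?_⟩
      simp only
      rw [← Function.iterate_add_apply]
      have : i + (p * j - j) + j = i + j * p := by
        have : j ≤ p * j := Nat.le_mul_of_pos_left j hp0
        rw [mul_comm j p]; omega
      rw [this, Function.iterate_add_apply, (hper.const_mul j).eq]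
  have hfix : ∀ j, γ (γ^[j] x) ≠ γ^[j] x := by
    intro j hj
    apply hx1
    have h2 : γ^[p * j - j] (γ^[j] x) = x := by
      rw [← Function.iterate_add_apply]
      have : p * j - j + j = j * p := by
        have : j ≤ p * j := Nat.le_mul_of_pos_left j hp0
        rw [mul_comm j p]; omega
      rw [this, (hper.const_mul j).eq]
    have h3 : γ^[p * j - j] (γ^[j] x) = γ^[j] x := Function.iterate_fixed hj _
    rw [← h2, h3, hj]
  obtain ⟨i, hi⟩ := hc x
  have hi' : γ^[i % p] x = c x := by
    rw [← hi, ← hmp]; exact Function.iterate_mod_minimalPeriod_eq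
  rw [Finset.sum_eq_single (i % p)]
  · refine if_pos ?_
    refine ⟨hfix _, ?_⟩
    rw [hcc _ _ (hO _), hi']
  · intro j hj hne
    refine if_neg ?_
    rintro ⟨_, h⟩
    rw [hcc _ _ (hO _), ← hi'] at h
    apply hne
    have h1 := Function.iterate_injOn_Iio_minimalPeriod (f := γ) (x := x)
    refine (h1 ?_ ?_ h).symm
    · rw [hmp]; exact Nat.mod_lt _ hp0
    · rw [hmp]; exact Finset.mem_range.1 hj
  · intro h; exact absurd (Finset.mem_range.2 (Nat.mod_lt _ hp0)) h

end Orbit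
section Step

variable {P : Type*} {p : ℕ}

theorem iter_map (g : P → P) (j : ℕ) (l : List P) : (List.map g)^[j] l = l.map (g^[j]) := by
  induction j generalizing l with
  | zero => simp
  | succ n ih => rw [Function.iterate_succ_apply, ih, List.map_map, Function.iterate_succ]

theorem iter_fix {g : P → P} {l : List P} (h : l.map g = l) (j : ℕ) : l.map (g^[j]) = l := by
  rw [← iter_map]; exact Function.iterate_fixed h j

theorem map_fix_iff {g : P → P} {l : List P} : l.map g = l ↔ ∀ a ∈ l, g a = a := by
  induction l with
  | nil => simp
  | cons a l ih => simp [ih]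

theorem sublist_fix {g : P → P} {l l' : List P} (h : l.map g = l) (hl : l'.Sublist l) :
    l'.map g = l' :=
  map_fix_iff.2 fun a ha => map_fix_iff.1 h a (hl.subset ha)

def sig (g : P → P) (p : ℕ) (f : List P → ZMod p) (l : List P) : ZMod p :=
  ∑ j ∈ Finset.range p, f (l.map (g^[j]))

def tau (g : P → P) (p : ℕ) (f : List P → ZMod p) (l : List P) : ZMod p :=
  f l - f (l.map g)

theorem dl_supp {R : Type*} [CommRing R] (l : List P) : ∀ (k : ℕ) (f : List P → R),
    (∀ l, l.length < k → f l = 0) → l.length < k + 1 → dl f l = 0 := by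
  induction l with
  | nil => intros; rfl
  | cons a l ih =>
    intro k f hf hl
    simp only [List.length_cons] at hl
    simp only [dl]
    rw [hf l (by omega)]
    cases k with
    | zero => omega
    | succ k =>
      rw [ih k _ (fun l' h => hf _ (by simpa using h)) (by omega), sub_zero]

variable [Preorder P]

def Ok (g : P → P) (p : ℕ) (D : P → Prop) : Prop :=
  (∀ a, D a → D (g a)) ∧ (∀ a, D a → g^[p] a = a)

structure GoodOp (g : P → P) (p : ℕ) (ρ : (List P → ZMod p) → List P → ZMod p) : Prop where
  nm : ∀ f, Nm f → Nm (ρ f)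
  dl : ∀ f l, dl (ρ f) l = ρ (dl f) l
  hm : ∀ r : P → P, (∀ a, g (r a) = r (g a)) → ∀ f l, hm id r (ρ f) l = ρ (hm id r f) l
  sub : ∀ f f' l, ρ (fun l => f l - f' l) l = ρ f l - ρ f' l
  loc : ∀ D, Ok g p D → ∀ f, (∀ l ∈ K D, f l = 0) → ∀ l ∈ K D, ρ f l = 0
  supp : ∀ k f, (∀ l, l.length < k → f l = 0) → ∀ l, l.length < k → ρ f l = 0
  fix : ∀ f l, l.map g = l → ρ f l = 0

structure GoodPair (g : P → P) (p : ℕ) (ρ ρ' : (List P → ZMod p) → List P → ZMod p) : Prop where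
  op : GoodOp g p ρ
  op' : GoodOp g p ρ'
  comp : ∀ D, Ok g p D → ∀ f, ∀ l ∈ K D, ρ (ρ' f) l = 0
  ker : ∀ D, Ok g p D → ∀ k h, Nm h → (∀ l, l.length < k → h l = 0) →
    (∀ l ∈ K D, ρ h l = 0) → (∀ l ∈ K D, l.map g = l → h l = 0) →
    ∃ u, Nm u ∧ (∀ l, l.length < k → u l = 0) ∧ (∀ l, l.map g = l → u l = 0) ∧
      ∀ l ∈ K D, h l = ρ' u l

variable {g : P → P} [hp : Fact p.Prime] (hg : Monotone g)

theorem Ok.iter {D : P → Prop} (h : Ok g p D) (j : ℕ) (a : P) (ha : D a) : D (g^[j] a) := by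
  induction j with
  | zero => exact ha
  | succ n ih => rw [Function.iterate_succ_apply']; exact h.1 _ ih

include hg in
theorem Ok.mapK {D : P → Prop} (h : Ok g p D) (j : ℕ) {l : List P} (hl : l ∈ K D) :
    l.map (g^[j]) ∈ K D :=
  K_map (hg.iterate j) (h.iter j) hl

theorem Ok.per {D : P → Prop} (h : Ok g p D) {l : List P} (hl : l ∈ K D) :
    l.map (g^[p]) = l := map_fix_iff.2 fun a ha => h.2 a (hl.1 a ha)

include hg in
theorem good_sig : GoodOp g p (sig g p) where
  nm f hf := by
    intro l₁ a l₂
    exact Finset.sum_eq_zero fun j _ => hf.map (g^[j]) l₁ a l₂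
  dl f l := by
    unfold sig
    rw [dl_sum]
    exact Finset.sum_congr rfl fun j _ => dl_map _ l f
  hm r hr f l := by
    unfold sig
    rw [hm_sum]
    refine Finset.sum_congr rfl fun j _ => hm_map id r (g^[j]) (fun _ => rfl) ?_ l f
    intro a
    exact (Function.Commute.iterate_left (f := g) (g := r) hr j) a
  sub f f' l := by simp [sig, Finset.sum_sub_distrib]
  loc D hD f hf l hl := Finset.sum_eq_zero fun j _ => hf _ (hD.mapK hg j hl)
  supp k f hf l hl := Finset.sum_eq_zero fun j _ => hf _ (by simpa using hl)
  fix f l hl := by simp [sig, iter_fix hl]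

include hg in
theorem good_tau : GoodOp g p (tau g p) where
  nm f hf := hf.sub (hf.map g)
  dl f l := by
    unfold tau
    rw [dl_sub, dl_map]
  hm r hr f l := by
    unfold tau
    rw [hm_sub, hm_map id r g (fun _ => rfl) hr]
  sub f f' l := by simp only [tau]; ring
  loc D hD f hf l hl := by
    have := hf _ (hD.mapK hg 1 hl)
    simp only [Function.iterate_one] at this
    simp [tau, hf l hl, this]
  supp k f hf l hl := by simp [tau, hf l hl, hf (l.map g) (by simpa using hl)]
  fix f l hl := by simp [tau, hl]

theorem sig_map {D : P → Prop} (hD : Ok g p D) (f : List P → ZMod p) {l : List P} (hl : l ∈ K D) :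
    sig g p f (l.map g) = sig g p f l := by
  have h1 := Finset.sum_range_succ (fun j => f (l.map (g^[j]))) p
  rw [Finset.sum_range_succ'] at h1
  simp only [hD.per hl, Function.iterate_zero, List.map_id] at h1
  have h2 := add_right_cancel h1
  simpa [sig, List.map_map, ← Function.iterate_succ] using h2

theorem sig_tau {D : P → Prop} (hD : Ok g p D) (f : List P → ZMod p) {l : List P} (hl : l ∈ K D) :
    sig g p (tau g p f) l = 0 := by
  have := sig_map hD f hl
  simp only [sig, tau, Finset.sum_sub_distrib] at this ⊢
  rw [sub_eq_zero, ← this]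
  refine Finset.sum_congr rfl fun j _ => ?_
  rw [List.map_map, List.map_map, ← Function.iterate_succ, ← Function.iterate_succ']

include hg in
theorem good_tau_sig : GoodPair g p (tau g p) (sig g p) where
  op := good_tau hg
  op' := good_sig hg
  comp D hD f l hl := by rw [tau, sig_map hD f hl, sub_self]
  ker D hD k h hnm hk hker hfix := by
    obtain ⟨e, he0, he1⟩ := exists_orbit_fun (List.map g) p
    refine ⟨fun l => e l * h l, ?_, ?_, ?_, ?_⟩
    · intro l₁ a l₂; simp [hnm l₁ a l₂]
    · intro l hl; simp [hk l hl]
    · intro l hl; simp [he0 l hl]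
    · intro l hl
      by_cases hf : l.map g = l
      · rw [(good_sig hg).fix _ _ hf, hfix l hl hf]
      · have hinv : ∀ j, h (l.map (g^[j])) = h l := by
          intro j
          induction j with
          | zero => simp
          | succ n ih =>
            have := hker _ (hD.mapK hg n hl)
            rw [tau, sub_eq_zero, List.map_map, ← Function.iterate_succ'] at this
            rw [← this, ih]
        have h1 := he1 l (by rw [iter_map]; exact hD.per hl) hf
        simp only [iter_map] at h1
        simp only [sig, hinv, ← Finset.sum_mul, h1, one_mul]

include hg in
theorem good_sig_tau : GoodPair g p (sig g p) (tau g p) where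
  op := good_sig hg
  op' := good_tau hg
  comp D hD f l hl := sig_tau hD f hl
  ker D hD k h hnm hk hker hfix := by
    obtain ⟨e, he0, he1⟩ := exists_orbit_fun (List.map g) p
    have hefix : ∀ l : List P, l.map g = l → ∀ j, e (l.map (g^[j])) = 0 := by
      intro l hl j; rw [iter_fix hl, he0 l hl]
    refine ⟨fun l => ∑ j ∈ Finset.range p, e (l.map (g^[j])) *
      ∑ i ∈ Finset.range j, h (l.map (g^[i])), ?_, ?_, ?_, ?_⟩
    · intro l₁ a l₂
      refine Finset.sum_eq_zero fun j _ => ?_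
      rw [Finset.sum_eq_zero (fun i _ => hnm.map (g^[i]) l₁ a l₂), mul_zero]
    · intro l hl
      refine Finset.sum_eq_zero fun j _ => ?_
      rw [Finset.sum_eq_zero (fun i _ => hk _ (by simpa using hl)), mul_zero]
    · intro l hl
      refine Finset.sum_eq_zero fun j _ => ?_
      rw [hefix l hl, zero_mul]
    · intro l hl
      by_cases hf : l.map g = l
      · rw [(good_tau hg).fix _ _ hf, hfix l hl hf]
      · have h1 := he1 l (by rw [iter_map]; exact hD.per hl) hf
        simp only [iter_map] at h1
        have hs : ∀ j, ∑ i ∈ Finset.range j, h ((l.map g).map (g^[i])) =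
            ∑ i ∈ Finset.range (j + 1), h (l.map (g^[i])) - h l := by
          intro j
          rw [Finset.sum_range_succ']
          simp [List.map_map, ← Function.iterate_succ]
        have he : ∀ j, e ((l.map g).map (g^[j])) = e (l.map (g^[j + 1])) := by
          intro j; rw [List.map_map, ← Function.iterate_succ]
        simp only [tau]
        simp only [hs, he, mul_sub, Finset.sum_sub_distrib, ← Finset.sum_mul]
        have h2 : ∑ j ∈ Finset.range p, e (l.map (g^[j + 1])) = 1 := by
          have h3 := Finset.sum_range_succ (fun j => e (l.map (g^[j]))) p
          rw [Finset.sum_range_succ'] at h3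
          simp only [hD.per hl, Function.iterate_zero, List.map_id] at h3
          rw [add_right_cancel h3, h1]
        have h4 : ∑ j ∈ Finset.range p, e (l.map (g^[j + 1])) *
              ∑ i ∈ Finset.range (j + 1), h (l.map (g^[i])) =
            ∑ j ∈ Finset.range p, e (l.map (g^[j])) * ∑ i ∈ Finset.range j, h (l.map (g^[i])) := by
          have h3 := Finset.sum_range_succ (fun j => e (l.map (g^[j])) *
            ∑ i ∈ Finset.range j, h (l.map (g^[i]))) p
          rw [Finset.sum_range_succ'] at h3
          have h5 : ∑ i ∈ Finset.range p, h (l.map (g^[i])) = 0 := hker l hl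
          simpa [h5] using h3
        rw [h2, h4]; ring

/-- The inductive Smith statement. -/
def SS (g : P → P) (p : ℕ) (ρ : (List P → ZMod p) → List P → ZMod p) (k : ℕ) (D D' : P → Prop) :
    Prop :=
  ∀ f, Nm f → (∀ l, l.length < k → f l = 0) → (∀ l ∈ K D, dl (ρ f) l = 0) →
    (∀ l ∈ K D, l.map g = l → dl f l = 0) →
    ∃ w, Nm w ∧ (∀ l ∈ K D', ρ f l = dl (ρ w) l) ∧ (∀ l ∈ K D', l.map g = l → f l = dl w l)

theorem SS_step {ρ ρ' : (List P → ZMod p) → List P → ZMod p} (hρ : GoodPair g p ρ ρ') {k : ℕ}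
    {D1 D2 D3 : P → Prop} (h12 : ∀ a, D2 a → D1 a)
    (ok1 : Ok g p D1) (ok3 : Ok g p D3)
    (hS : SS g p ρ' (k + 1) D1 D2) (hT : Triv (ZMod p) D2 D3) : SS g p ρ k D1 D3 := by
  intro f hf hk hc hcf
  obtain ⟨u, hu, huk, huf, hue⟩ := hρ.ker D1 ok1 (k + 1) (dl f) hf.dl
    (fun l hl => dl_supp l k f hk hl) (fun l hl => by rw [← hρ.op.dl]; exact hc l hl) hcf
  obtain ⟨w1, hw1, hw1e, -⟩ := hS u hu huk
    (fun l hl => by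
      rw [← dl_congr_K (f := dl f) (f' := ρ' u) hue hl]; exact dl_dl l f)
    (fun l hl hlf => by
      rw [dl_congr l u (fun _ => 0) (fun l' h => huf l' (sublist_fix hlf h)), dl_zero])
  have hnm' : Nm (fun l => f l - ρ' w1 l) := hf.sub (hρ.op'.nm w1 hw1)
  obtain ⟨w, hw, hwe⟩ := hT _ hnm' (fun l hl => by
    rw [dl_sub, ← hw1e l hl, hue l (K_mono h12 hl), sub_self])
  refine ⟨w, hw, ?_, ?_⟩
  · intro l hl
    have h1 : ρ (fun l => (f l - ρ' w1 l) - dl w l) l = 0 :=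
      hρ.op.loc D3 ok3 _ (fun l hl => by rw [hwe l hl, sub_self]) l hl
    rw [hρ.op.sub, hρ.op.sub, hρ.comp D3 ok3 w1 l hl, sub_zero] at h1
    rw [hρ.op.dl]; exact sub_eq_zero.1 h1
  · intro l hl hlf
    rw [← hwe l hl, hρ.op'.fix w1 l hlf, sub_zero]

theorem K_fix {D : P → Prop} {l : List P} :
    l ∈ K (fun a => D a ∧ g a = a) ↔ l ∈ K D ∧ l.map g = l := by
  constructor
  · intro h
    exact ⟨K_mono (fun _ h => h.1) h, map_fix_iff.2 fun a ha => (h.1 a ha).2⟩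
  · rintro ⟨h1, h2⟩
    exact ⟨fun a ha => ⟨h1.1 a ha, map_fix_iff.1 h2 a ha⟩, h1.2⟩

theorem SS_base {ρ : (List P → ZMod p) → List P → ZMod p} (hρ : GoodOp g p ρ) {k : ℕ}
    {D1 D2 : P → Prop} (h12 : ∀ a, D2 a → D1 a) {r : P → P} (hr : Monotone r)
    (hr1 : ∀ a, a ≤ r a) (hrD : ∀ a, D2 a → D1 (r a)) (hrg : ∀ a, g (r a) = r (g a))
    (hrep : ∀ l ∈ K D2, k ≤ l.length → ∃ l₁ a l₂, l.map r = l₁ ++ a :: a :: l₂) :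
    SS g p ρ k D1 D2 := by
  intro f hf hk hc hcf
  have hz : ∀ f : List P → ZMod p, Nm f → (∀ l, l.length < k → f l = 0) →
      ∀ l ∈ K D2, f (l.map r) = 0 := by
    intro f hf hk l hl
    by_cases h : l.length < k
    · exact hk _ (by simpa using h)
    · obtain ⟨l₁, a, l₂, e⟩ := hrep l hl (by omega)
      rw [e]; exact hf _ _ _
  have hρ0 : ∀ l, ρ (fun _ => 0) l = 0 := by
    intro l
    have := hρ.sub (fun _ => 0) (fun _ => 0) l
    simpa using this
  refine ⟨fun l => 0 - hm id r f l, ?_, ?_, ?_⟩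
  · exact Nm.sub (fun _ _ _ => rfl) (hf.hm id r)
  · intro l hl
    have h1 := homotopy (D := D2) (D' := D1) monotone_id hr hr1 h12 hrD (ρ f) hc l hl
    rw [hz (ρ f) (hρ.nm f hf) (hρ.supp k f hk) l hl] at h1
    have h2 : ρ (fun l => 0 - hm id r f l) = fun l => 0 - hm id r (ρ f) l := by
      funext l
      rw [hρ.sub, hρ0, hρ.hm r hrg]
    rw [h2, dl_sub, dl_zero, ← h1]; simp
  · intro l hl hlf
    have h1 := homotopy (D := fun a => D2 a ∧ g a = a) (D' := fun a => D1 a ∧ g a = a)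
      monotone_id hr hr1 (fun a ha => ⟨h12 a ha.1, ha.2⟩)
      (fun a ha => ⟨hrD a ha.1, by rw [hrg, ha.2]⟩) f
      (fun l hl => hcf l (K_fix.1 hl).1 (K_fix.1 hl).2) l (K_fix.2 ⟨hl, hlf⟩)
    rw [hz f hf hk l hl] at h1
    rw [dl_sub, dl_zero, ← h1]; simp

include hg in
theorem SS_triv (hinj : Function.Injective g) {D D' : P → Prop}
    (h : SS g p (sig g p) 0 D D') :
    Triv (ZMod p) (fun a => D a ∧ g a = a) (fun a => D' a ∧ g a = a) := by
  classical
  intro f hf hc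
  let f' : List P → ZMod p := fun l => if l.map g = l then f l else 0
  have hf' : Nm f' := by
    intro l₁ a l₂; simp only [f']; rw [hf l₁ a l₂]; simp
  have hs : sig g p f' = fun _ => 0 := by
    funext l
    by_cases hl : l.map g = l
    · exact (good_sig hg).fix f' l hl
    · refine Finset.sum_eq_zero fun j _ => if_neg ?_
      rw [List.map_map, ← Function.iterate_succ', Function.iterate_succ, ← List.map_map]
      intro hj
      exact hl ((List.map_injective_iff.2 (hinj.iterate j))
        (by simpa [List.map_map] using hj))
  obtain ⟨w, hw, -, hwf⟩ := h f' hf' (fun l hl => absurd hl (by omega))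
    (fun l hl => by rw [hs, dl_zero])
    (fun l hl hlf => by
      rw [dl_congr l f' f (fun l' h => if_pos (sublist_fix hlf h))]
      exact hc l (K_fix.2 ⟨hl, hlf⟩))
  refine ⟨w, hw, fun l hl => ?_⟩
  rw [← hwf l (K_fix.1 hl).1 (K_fix.1 hl).2]
  exact (if_pos (K_fix.1 hl).2).symm

/-- Eventual validity in a two-parameter family. -/
def Ev (D : ℝ → ℝ → P → Prop) (T : (P → Prop) → (P → Prop) → Prop) : Prop :=
  ∀ R, ∃ R' ≥ R, ∀ ε' > 0, ∃ ε > 0, ε ≤ ε' ∧ T (D R' ε') (D R ε)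

include hg in
theorem smith_step (hinj : Function.Injective g) (D : ℝ → ℝ → P → Prop)
    (hmono : ∀ R R' ε ε', R ≤ R' → ε ≤ ε' → ∀ a, D R ε a → D R' ε' a)
    (hok : ∀ R ε, Ok g p (D R ε)) (k : ℕ)
    (hbase : Ev D (fun D1 D2 => ∃ r : P → P, Monotone r ∧ (∀ a, a ≤ r a) ∧
      (∀ a, D2 a → D1 (r a)) ∧ (∀ a, g (r a) = r (g a)) ∧
      (∀ l ∈ K D2, k ≤ l.length → ∃ l₁ a l₂, l.map r = l₁ ++ a :: a :: l₂)))
    (hT : Ev D (Triv (ZMod p))) :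
    Ev (fun R ε a => D R ε a ∧ g a = a) (Triv (ZMod p)) := by
  have base : ∀ ρ, GoodOp g p ρ → Ev D (SS g p ρ k) := by
    intro ρ hρ R
    obtain ⟨R', hR, h⟩ := hbase R
    refine ⟨R', hR, fun ε' hε' => ?_⟩
    obtain ⟨ε, hε, hle, r, h1, h2, h3, h4, h5⟩ := h ε' hε'
    exact ⟨ε, hε, hle, SS_base hρ (hmono _ _ _ _ hR hle) h1 h2 h3 h4 h5⟩
  have step : ∀ ρ ρ' j, GoodPair g p ρ ρ' → Ev D (SS g p ρ' (j + 1)) → Ev D (SS g p ρ j) := by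
    intro ρ ρ' j hρ hS R
    obtain ⟨R1, hR1, h1⟩ := hT R
    obtain ⟨R2, hR2, h2⟩ := hS R1
    refine ⟨R2, hR1.le.trans hR2, fun ε2 hε2 => ?_⟩
    obtain ⟨ε1, hε1, hle1, h3⟩ := h2 ε2 hε2
    obtain ⟨ε, hε, hle, h4⟩ := h1 ε1 hε1
    exact ⟨ε, hε, hle.trans hle1, SS_step hρ (hmono _ _ _ _ hR2 hle1)
      (hok _ _) (hok _ _) h3 h4⟩
  have main : ∀ i j, i + j = k → Ev D (SS g p (sig g p) j) ∧ Ev D (SS g p (tau g p) j) := by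
    intro i
    induction i with
    | zero =>
      intro j hj
      obtain rfl : j = k := by omega
      exact ⟨base _ (good_sig hg), base _ (good_tau hg)⟩
    | succ i ih =>
      intro j hj
      obtain ⟨h1, h2⟩ := ih (j + 1) (by omega)
      exact ⟨step _ _ j (good_sig_tau hg) h2, step _ _ j (good_tau_sig hg) h1⟩
  intro R
  obtain ⟨R', hR, h⟩ := (main k 0 rfl).1 R
  refine ⟨R', hR, fun ε' hε' => ?_⟩
  obtain ⟨ε, hε, hle, h1⟩ := h ε' hε'
  exact ⟨ε, hε, hle, SS_triv hg hinj h1⟩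

end Step

section Geometry

open Pointwise

variable {n : ℕ} {G : Type*} [Group G] [Finite G] [MulAction G (Fin n → ℝ)]
  (hcont : ∀ g : G, Continuous (fun x : Fin n → ℝ => g • x))

include hcont in
theorem exists_bound (R : ℝ) : ∃ R', ∀ x : Fin n → ℝ, ‖x‖ ≤ R → ∀ g : G, ‖g • x‖ ≤ R' := by
  have h : ∀ g : G, ∃ C, ∀ x : Fin n → ℝ, ‖x‖ ≤ R → ‖g • x‖ ≤ C := by
    intro g
    obtain ⟨C, hC⟩ := (isCompact_closedBall (0 : Fin n → ℝ) R).exists_bound_of_continuousOn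
      (hcont g).continuousOn
    exact ⟨C, fun x hx => hC x (by simpa using hx)⟩
  choose C hC using h
  obtain ⟨M, hM⟩ := (Set.finite_range C).bddAbove
  exact ⟨M, fun x hx g => (hC g x hx).trans (hM ⟨g, rfl⟩)⟩

include hcont in
theorem exists_unif (R ε : ℝ) (hε : 0 < ε) : ∃ δ > 0, ∀ x y : Fin n → ℝ, ‖x‖ ≤ R → ‖y‖ ≤ R →
    dist x y ≤ δ → ∀ g : G, dist (g • x) (g • y) ≤ ε := by
  have h : ∀ g : G, ∃ δ > 0, ∀ x y : Fin n → ℝ, ‖x‖ ≤ R → ‖y‖ ≤ R →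
      dist x y < δ → dist (g • x) (g • y) ≤ ε := by
    intro g
    have h1 := (isCompact_closedBall (0 : Fin n → ℝ) R).uniformContinuousOn_of_continuous
      (hcont g).continuousOn
    obtain ⟨δ, hδ, h2⟩ := Metric.uniformContinuousOn_iff.1 h1 ε hε
    exact ⟨δ, hδ, fun x y hx hy hxy =>
      (h2 x (by simpa using hx) y (by simpa using hy) hxy).le⟩
  choose δ hδ h using h
  obtain ⟨g0, hg0⟩ := Finite.exists_min δ
  refine ⟨δ g0 / 2, half_pos (hδ g0), fun x y hx hy hxy g => h g x y hx hy ?_⟩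
  have := hg0 g
  have := hδ g0
  linarith

/-- Small bounded sets, invariant under `H`. -/
def DH (H : Subgroup G) (R ε : ℝ) (A : Set (Fin n → ℝ)) : Prop :=
  (A.Nonempty ∧ (∀ x ∈ A, ∀ g : G, ‖g • x‖ ≤ R) ∧
    ∀ x ∈ A, ∀ y ∈ A, ∀ g : G, dist (g • x) (g • y) ≤ ε) ∧ ∀ h ∈ H, h • A = A

theorem DH_mono (H : Subgroup G) (R R' ε ε' : ℝ) (hR : R ≤ R') (hε : ε ≤ ε')
    (A : Set (Fin n → ℝ)) (h : DH H R ε A) : DH H R' ε' A :=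
  ⟨⟨h.1.1, fun x hx g => (h.1.2.1 x hx g).trans hR,
    fun x hx y hy g => (h.1.2.2 x hx y hy g).trans hε⟩, h.2⟩

theorem DH_smul {H : Subgroup G} {g : G} (hg : ∀ h ∈ H, g⁻¹ * h * g ∈ H) {R ε : ℝ}
    {A : Set (Fin n → ℝ)} (h : DH H R ε A) : DH H R ε (g • A) := by
  refine ⟨⟨h.1.1.smul_set, ?_, ?_⟩, ?_⟩
  · rintro _ ⟨x, hx, rfl⟩ k
    simp only [smul_smul]
    exact h.1.2.1 x hx _
  · rintro _ ⟨x, hx, rfl⟩ _ ⟨y, hy, rfl⟩ k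
    simp only [smul_smul]
    exact h.1.2.2 x hx y hy _
  · intro k hk
    have := h.2 _ (hg k hk)
    nth_rewrite 2 [← this]
    rw [smul_smul, smul_smul]
    congr 1; group

noncomputable def q (η : ℝ) (x : Fin n → ℝ) : Fin n → ℤ := fun i => ⌊x i / η⌋

theorem dist_le_of_q {η : ℝ} (hη : 0 < η) {x y : Fin n → ℝ} (h : q η x = q η y) :
    dist x y ≤ η := by
  refine (dist_pi_le_iff hη.le).2 fun i => ?_
  have h1 : ⌊x i / η⌋ = ⌊y i / η⌋ := congrFun h i
  have h2 := Int.abs_sub_lt_one_of_floor_eq_floor h1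
  rw [← sub_div, abs_div, abs_of_pos hη, div_lt_one hη] at h2
  exact h2.le

theorem q_near {η : ℝ} (hη : 0 < η) {x y : Fin n → ℝ} (h : dist x y ≤ η) (i : Fin n) :
    ∃ d : Fin 3, q η x i = q η y i + ((d : ℕ) : ℤ) - 1 := by
  have h1 : |x i - y i| ≤ η := (dist_le_pi_dist x y i).trans h
  have h2 : |x i / η - y i / η| ≤ 1 := by
    rw [← sub_div, abs_div, abs_of_pos hη]; exact (div_le_one hη).2 h1
  obtain ⟨h3, h4⟩ := abs_le.1 h2
  have h5 : q η x i ≤ q η y i + 1 := by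
    simp only [q]
    rw [← Int.floor_add_one]; exact Int.floor_le_floor (by linarith)
  have h6 : q η y i ≤ q η x i + 1 := by
    simp only [q]
    rw [← Int.floor_add_one]; exact Int.floor_le_floor (by linarith)
  refine ⟨⟨(q η x i - q η y i + 1).toNat, by omega⟩, ?_⟩
  simp only
  omega

/-- Saturation by cells. -/
def sat (G : Type*) [Group G] [MulAction G (Fin n → ℝ)] (η : ℝ) (A : Set (Fin n → ℝ)) :
    Set (Fin n → ℝ) :=
  {y | ∃ g : G, ∃ x ∈ A, q η (g • y) = q η (g • x)}

/-- Cells met by a set. -/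
def cells (G : Type*) [Group G] [MulAction G (Fin n → ℝ)] (η : ℝ) (A : Set (Fin n → ℝ)) :
    Set (G × (Fin n → ℤ)) :=
  {c | ∃ x ∈ A, q η (c.1 • x) = c.2}

theorem sat_smul (η : ℝ) (h : G) (A : Set (Fin n → ℝ)) : h • sat G η A = sat G η (h • A) := by
  ext y
  rw [Set.mem_smul_set_iff_inv_smul_mem]
  constructor
  · rintro ⟨g, x, hx, e⟩
    refine ⟨g * h⁻¹, h • x, Set.smul_mem_smul_set hx, ?_⟩
    simpa [mul_smul] using e
  · rintro ⟨g, _, ⟨x, hx, rfl⟩, e⟩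
    refine ⟨g * h, x, hx, ?_⟩
    simpa [mul_smul] using e

theorem sat_eq_of_cells {η : ℝ} {A B : Set (Fin n → ℝ)} (h : cells G η A = cells G η B) :
    sat G η A = sat G η B := by
  have key : ∀ A : Set (Fin n → ℝ), sat G η A = {y | ∃ g : G, (g, q η (g • y)) ∈ cells G η A} := by
    intro A
    ext y
    constructor
    · rintro ⟨g, x, hx, e⟩; exact ⟨g, x, hx, e.symm⟩
    · rintro ⟨g, x, hx, e⟩; exact ⟨g, x, hx, e.symm⟩
  rw [key, key, h]

theorem cells_card {H : Subgroup G} {R ε η : ℝ} (hη : 0 < η) (hε : ε ≤ η) {A : Set (Fin n → ℝ)}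
    (hA : DH H R ε A) : (cells G η A).Finite ∧ (cells G η A).ncard ≤ Nat.card G * 3 ^ n := by
  obtain ⟨x0, hx0⟩ := hA.1.1
  let F : G × (Fin n → Fin 3) → G × (Fin n → ℤ) :=
    fun c => (c.1, fun i => q η (c.1 • x0) i + ((c.2 i : ℕ) : ℤ) - 1)
  have hsub : cells G η A ⊆ Set.range F := by
    rintro ⟨g, v⟩ ⟨x, hx, e⟩
    simp only at e
    have := fun i => q_near hη ((hA.1.2.2 x hx x0 hx0 g).trans hε) i
    choose d hd using this
    refine ⟨(g, d), ?_⟩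
    simp only [F, Prod.mk.injEq, true_and]
    funext i
    rw [← hd i, e]
  have hfin : (Set.range F).Finite := Set.finite_range F
  refine ⟨hfin.subset hsub, (Set.ncard_le_ncard hsub hfin).trans ?_⟩
  have h1 : (Set.range F).ncard ≤ Nat.card (G × (Fin n → Fin 3)) := by
    rw [← Set.image_univ]
    refine (Set.ncard_image_le Set.finite_univ).trans ?_
    rw [Set.ncard_univ]
  refine h1.trans ?_
  rw [Nat.card_prod]
  simp

theorem exists_repeat {P ι : Type*} [Preorder P] (r : P → P) (S : P → Set ι) (hS : Monotone S)
    (hr : ∀ a b, S a = S b → r a = r b) (l : List P) : ∀ a : P, (a :: l).Pairwise (· ≤ ·) →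
    (∀ b ∈ a :: l, (S b).Finite) →
    (∃ l₁ b l₂, (a :: l).map r = l₁ ++ b :: b :: l₂) ∨
      ∃ b ∈ a :: l, (S a).ncard + l.length ≤ (S b).ncard := by
  induction l with
  | nil => intro a _ _; right; exact ⟨a, by simp, by simp⟩
  | cons c l ih =>
    intro a hp hf
    rcases ih c (List.pairwise_cons.1 hp).2 (fun b hb => hf b (List.mem_cons_of_mem _ hb)) with
      ⟨l₁, b, l₂, e⟩ | ⟨b, hb, hle⟩
    · left
      refine ⟨r a :: l₁, b, l₂, ?_⟩
      rw [List.map_cons, e]; rfl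
    · by_cases hac : S a = S c
      · left
        refine ⟨[], r c, l.map r, ?_⟩
        simp [hr a c hac]
      · right
        refine ⟨b, List.mem_cons_of_mem _ hb, ?_⟩
        have hle' : S a ≤ S c := hS ((List.pairwise_cons.1 hp).1 c (by simp))
        have hlt : (S a).ncard < (S c).ncard :=
          Set.ncard_lt_ncard (lt_of_le_of_ne hle' hac) (hf c (by simp))
        simp only [List.length_cons] at hle ⊢
        omega

include hcont in
theorem base_ev (H : Subgroup G) (g0 : G) :
    Ev (DH (n := n) H) (fun D1 D2 => ∃ r : Set (Fin n → ℝ) → Set (Fin n → ℝ),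
      Monotone r ∧ (∀ a, a ≤ r a) ∧
      (∀ a, D2 a → D1 (r a)) ∧ (∀ a, g0 • (r a) = r (g0 • a)) ∧
      (∀ l ∈ K D2, Nat.card G * 3 ^ n + 2 ≤ l.length →
        ∃ l₁ a l₂, l.map r = l₁ ++ a :: a :: l₂)) := by
  intro R
  refine ⟨R + 1, by simp, fun ε' hε' => ?_⟩
  have hε1 : 0 < min 1 (ε' / 3) := lt_min one_pos (by linarith)
  obtain ⟨δ, hδ, hU⟩ := exists_unif hcont (R + 1) (min 1 (ε' / 3)) hε1
  set η := min δ 1 with hη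
  have hη0 : 0 < η := lt_min hδ one_pos
  refine ⟨min η (ε' / 3), lt_min hη0 (by linarith), (min_le_right _ _).trans (by linarith),
    sat G η, ?_, ?_, ?_, fun a => sat_smul η g0 a, ?_⟩
  · rintro A B hAB y ⟨g, x, hx, e⟩
    exact ⟨g, x, hAB hx, e⟩
  · intro A y hy
    exact ⟨1, y, hy, rfl⟩
  · intro A hA
    have key : ∀ y ∈ sat G η A, ∃ x ∈ A, ∀ h : G, dist (h • y) (h • x) ≤ min 1 (ε' / 3) := by
      rintro y ⟨g, x, hx, e⟩
      refine ⟨x, hx, fun h => ?_⟩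
      have h1 : dist (g • y) (g • x) ≤ η := dist_le_of_q hη0 e
      have h2 : ‖g • x‖ ≤ R := hA.1.2.1 x hx g
      have h3 : ‖g • y‖ ≤ R + 1 := by
        have := norm_le_norm_add_norm_sub' (g • y) (g • x)
        rw [← dist_eq_norm] at this
        have : η ≤ 1 := min_le_right _ _
        linarith
      have h4 := hU (g • y) (g • x) h3 (by linarith) (h1.trans (min_le_left _ _)) (h * g⁻¹)
      simpa [mul_smul] using h4
    refine ⟨⟨?_, ?_, ?_⟩, ?_⟩
    · obtain ⟨x, hx⟩ := hA.1.1
      exact ⟨x, 1, x, hx, rfl⟩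
    · intro y hy h
      obtain ⟨x, hx, hd⟩ := key y hy
      have h1 := (hd h).trans (min_le_left _ _)
      have h2 := hA.1.2.1 x hx h
      have := norm_le_norm_add_norm_sub' (h • y) (h • x)
      rw [← dist_eq_norm] at this
      linarith
    · intro y hy y' hy' h
      obtain ⟨x, hx, hd⟩ := key y hy
      obtain ⟨x', hx', hd'⟩ := key y' hy'
      have h1 := (hd h).trans (min_le_right _ _)
      have h2 := (hd' h).trans (min_le_right _ _)
      have h3 := (hA.1.2.2 x hx x' hx' h).trans (min_le_right _ _)
      rw [dist_comm] at h2
      have := dist_triangle4 (h • y) (h • x) (h • x') (h • y')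
      linarith
    · intro h hh
      rw [sat_smul, hA.2 h hh]
  · intro l hl hlen
    cases l with
    | nil => simp at hlen
    | cons a l =>
      have hc : ∀ b ∈ a :: l, (cells G η b).Finite ∧ (cells G η b).ncard ≤ Nat.card G * 3 ^ n :=
        fun b hb => cells_card hη0 (min_le_left _ _) (hl.1 b hb)
      rcases exists_repeat (sat G η) (cells G η) (fun A B hAB c ⟨x, hx, e⟩ => ⟨x, hAB hx, e⟩)
        (fun a b h => sat_eq_of_cells h) l a hl.2 (fun b hb => (hc b hb).1) with h | ⟨b, hb, h⟩
      · exact h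
      · have := (hc b hb).2
        simp only [List.length_cons] at hlen
        omega

include hcont in
theorem triv_bot (F : Type*) [CommRing F] :
    Ev (DH (n := n) (⊥ : Subgroup G)) (Triv F) := by
  intro R
  obtain ⟨R1, hR1⟩ := exists_bound hcont (max R 0)
  refine ⟨max R R1, le_max_left _ _, fun ε' hε' => ?_⟩
  obtain ⟨δ, hδ, hU⟩ := exists_unif hcont (max R 0) ε' hε'
  obtain ⟨N, hN⟩ := exists_nat_gt (max R 0 / (δ / 2))
  have hN0 : (0 : ℝ) < N := lt_of_le_of_lt (by positivity) hN
  have hN1 : max R 0 / N ≤ δ / 2 := by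
    rw [div_le_iff₀ hN0]
    rw [div_lt_iff₀ (by linarith)] at hN
    linarith
  refine ⟨min (δ / 2) ε', lt_min (by linarith) hε', min_le_right _ _, ?_⟩
  set ε := min (δ / 2) ε' with hεdef
  have hbot : ∀ A : Set (Fin n → ℝ), ∀ h ∈ (⊥ : Subgroup G), h • A = A := by
    intro A h hh
    rw [Subgroup.mem_bot.1 hh, one_smul]
  -- small sets in the ball of radius `max R 0` are admissible
  have hgood : ∀ B : Set (Fin n → ℝ), B.Nonempty → (∀ x ∈ B, ‖x‖ ≤ max R 0) →
      (∀ x ∈ B, ∀ y ∈ B, dist x y ≤ δ) → DH (⊥ : Subgroup G) (max R R1) ε' B := by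
    intro B h1 h2 h3
    exact ⟨⟨h1, fun x hx g => (hR1 x (h2 x hx) g).trans (le_max_right _ _),
      fun x hx y hy g => hU x y (h2 x hx) (h2 y hy) (h3 x hx y hy) g⟩, hbot B⟩
  let r : ℕ → Set (Fin n → ℝ) → Set (Fin n → ℝ) := fun i A => (fun x => ((i : ℝ) / N) • x) '' A
  have hrm : ∀ i, Monotone (r i) := fun i A B h => Set.image_mono h
  let χ : ℕ → Set (Fin n → ℝ) → Set (Fin n → ℝ) := fun i A => r i A ∪ r (i + 1) A
  have hχm : ∀ i, Monotone (χ i) := fun i A B h =>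
    Set.union_subset_union (hrm i h) (hrm (i + 1) h)
  have hχ : ∀ i, i < N → ∀ A, DH (⊥ : Subgroup G) R ε A →
      DH (⊥ : Subgroup G) (max R R1) ε' (χ i A) := by
    intro i hi A hA
    have hn : ∀ x ∈ A, ‖x‖ ≤ max R 0 := fun x hx => by
      have := hA.1.2.1 x hx 1
      rw [one_smul] at this
      exact this.trans (le_max_left _ _)
    have hd : ∀ x ∈ A, ∀ y ∈ A, dist x y ≤ δ / 2 := fun x hx y hy => by
      have := hA.1.2.2 x hx y hy 1
      rw [one_smul, one_smul] at this
      exact this.trans (min_le_left _ _)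
    have hel : ∀ z ∈ χ i A, ∃ t : ℝ, ∃ x ∈ A, z = t • x ∧ (i : ℝ) / N ≤ t ∧
        t ≤ ((i : ℝ) + 1) / N := by
      rintro z (⟨x, hx, rfl⟩ | ⟨x, hx, rfl⟩)
      · refine ⟨_, x, hx, rfl, le_rfl, ?_⟩
        gcongr; linarith
      · refine ⟨_, x, hx, rfl, ?_, ?_⟩
        · push_cast; gcongr; linarith
        · push_cast; exact le_rfl
    have h0 : (0 : ℝ) ≤ (i : ℝ) / N := by positivity
    have h1 : ((i : ℝ) + 1) / N ≤ 1 := by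
      rw [div_le_one hN0]; exact_mod_cast hi
    refine hgood _ ?_ ?_ ?_
    · obtain ⟨x, hx⟩ := hA.1.1
      exact ⟨_, Or.inl ⟨x, hx, rfl⟩⟩
    · intro z hz
      obtain ⟨t, x, hx, rfl, ht0, ht1⟩ := hel z hz
      rw [norm_smul, Real.norm_eq_abs, abs_of_nonneg (h0.trans ht0)]
      calc t * ‖x‖ ≤ 1 * ‖x‖ := by gcongr; linarith
        _ ≤ max R 0 := by rw [one_mul]; exact hn x hx
    · intro z hz z' hz'
      obtain ⟨t, x, hx, rfl, ht0, ht1⟩ := hel z hz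
      obtain ⟨s, y, hy, rfl, hs0, hs1⟩ := hel z' hz'
      have e : t • x - s • y = t • (x - y) + (t - s) • y := by
        rw [smul_sub, sub_smul]; abel
      have hts : |t - s| ≤ 1 / N := by
        have : ((i : ℝ) + 1) / N = (i : ℝ) / N + 1 / N := by ring
        rw [abs_le]; constructor <;> linarith
      rw [dist_eq_norm, e]
      refine (norm_add_le _ _).trans ?_
      rw [norm_smul, norm_smul, Real.norm_eq_abs, Real.norm_eq_abs, abs_of_nonneg (h0.trans ht0),
        ← dist_eq_norm]
      have b1 : t * dist x y ≤ 1 * (δ / 2) := by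
        gcongr
        · linarith
        · exact hd x hx y hy
      have b2 : |t - s| * ‖y‖ ≤ 1 / N * max R 0 := by
        gcongr
        exact hn y hy
      have b3 : 1 / N * max R 0 = max R 0 / N := by ring
      linarith
  have hsubset : ∀ A B : Set (Fin n → ℝ), A ⊆ B → A.Nonempty →
      DH (⊥ : Subgroup G) (max R R1) ε' B → DH (⊥ : Subgroup G) (max R R1) ε' A :=
    fun A B hAB hne hB => ⟨⟨hne, fun x hx => hB.1.2.1 x (hAB hx),
      fun x hx y hy => hB.1.2.2 x (hAB hx) y (hAB hy)⟩, hbot A⟩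
  intro f hf hc
  have claim : ∀ i, i ≤ N → ∃ w : List (Set (Fin n → ℝ)) → F, Nm w ∧
      ∀ l ∈ K (DH (n := n) (⊥ : Subgroup G) R ε), f (l.map (r i)) - f (l.map (r 0)) = dl w l := by
    intro i
    induction i with
    | zero =>
      intro _
      exact ⟨fun _ => 0, fun _ _ _ => rfl, fun l _ => by rw [dl_zero, sub_self]⟩
    | succ i ih =>
      intro hi
      obtain ⟨w, hw, hwe⟩ := ih (by omega)
      refine ⟨fun l => (w l + hm (r i) (χ i) f l) - hm (r (i + 1)) (χ i) f l,
        (hw.add (hf.hm _ _)).sub (hf.hm _ _), fun l hl => ?_⟩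
      have e1 := homotopy (hrm i) (hχm i) (fun A => Set.subset_union_left)
        (fun A hA => hsubset _ _ Set.subset_union_left (hA.1.1.image _) (hχ i hi A hA))
        (hχ i hi) f hc l hl
      have e2 := homotopy (hrm (i + 1)) (hχm i) (fun A => Set.subset_union_right)
        (fun A hA => hsubset _ _ Set.subset_union_right (hA.1.1.image _) (hχ i hi A hA))
        (hχ i hi) f hc l hl
      rw [dl_sub, dl_add, ← e1, ← e2, ← hwe l hl]
      ring
  obtain ⟨w, hw, hwe⟩ := claim N le_rfl
  have hrN : r N = id := by
    funext A
    simp [r, div_self hN0.ne']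
  have hr0 : ∀ A : Set (Fin n → ℝ), A.Nonempty → r 0 A = {0} := by
    intro A hA
    simp only [r, Nat.cast_zero, zero_div, zero_smul]
    exact hA.image_const 0
  let w0 : List (Set (Fin n → ℝ)) → F := fun l => match l with
    | [] => f [{0}]
    | _ :: _ => 0
  have hw0 : Nm w0 := by
    intro l₁ a l₂
    cases l₁ <;> rfl
  refine ⟨fun l => w l + w0 l, hw.add hw0, fun l hl => ?_⟩
  have h1 := hwe l hl
  rw [hrN, List.map_id] at h1
  rw [dl_add, ← h1]
  suffices h : f (l.map (r 0)) = dl w0 l by rw [h]; ring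
  cases l with
  | nil =>
    have h2 := hc [{0}] ⟨fun a ha => by
      obtain rfl := List.mem_singleton.1 ha
      refine hgood _ ⟨0, rfl⟩ ?_ ?_
      · intro x hx
        rw [Set.mem_singleton_iff.1 hx, norm_zero]; exact le_max_right _ _
      · intro x hx y hy
        rw [Set.mem_singleton_iff.1 hx, Set.mem_singleton_iff.1 hy, dist_self]; exact hδ.le,
      List.pairwise_singleton _ _⟩
    simpa [dl] using h2
  | cons a l =>
    have ha : r 0 a = {0} := hr0 a (hl.1 a (by simp)).1.1
    cases l with
    | nil => simp [dl, ha, w0]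
    | cons b l =>
      have hb : r 0 b = {0} := hr0 b (hl.1 b (by simp)).1.1
      have h2 := hf [] {0} (l.map (r 0))
      simp only [List.nil_append] at h2
      simp only [List.map_cons, ha, hb, h2, dl, w0]
      rw [dl_zero]; ring

theorem exists_chain {p m : ℕ} [hp : Fact p.Prime] {H : Subgroup G} (hH : Nat.card H = p ^ m)
    (hd : p ^ (m + 1) ∣ Nat.card G) : ∃ (H' : Subgroup G) (g : G), Nat.card H' = p ^ (m + 1) ∧
      (∀ h ∈ H, g⁻¹ * h * g ∈ H) ∧ g ^ p ∈ H ∧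
      ∀ S : Subgroup G, H ≤ H' ∧ g ∈ H' ∧ (H ≤ S → g ∈ S → H' ≤ S) := by
  obtain ⟨H', hH', hle⟩ := Sylow.exists_subgroup_card_pow_succ hd hH
  have hrel : H.relIndex H' = p := by
    have := Subgroup.card_mul_index (H.subgroupOf H')
    rw [Nat.card_congr (Subgroup.subgroupOfEquivOfLe hle).toEquiv, hH, hH', pow_succ] at this
    exact Nat.eq_of_mul_eq_mul_left (pow_pos hp.1.pos m) this
  have hnorm : (H.subgroupOf H').Normal := by
    apply Subgroup.normal_of_index_eq_minFac_card
    rw [hH', Nat.pow_minFac (by omega), hp.1.minFac_eq]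
    exact hrel
  have hlt : H < H' := by
    refine lt_of_le_of_ne hle ?_
    rintro rfl
    rw [Subgroup.relIndex_self] at hrel
    exact hp.1.one_lt.ne hrel
  obtain ⟨g, hgH', hgH⟩ := Set.exists_of_ssubset hlt
  refine ⟨H', g, hH', ?_, ?_, fun S => ⟨hle, hgH', ?_⟩⟩
  · intro h hh
    have := hnorm.conj_mem ⟨h, hle hh⟩ (Subgroup.mem_subgroupOf.2 hh) ⟨g⁻¹, H'.inv_mem hgH'⟩
    simpa [Subgroup.mem_subgroupOf] using this
  · have := Subgroup.pow_index_mem (H.subgroupOf H') ⟨g, hgH'⟩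
    have h2 : (H.subgroupOf H').index = p := hrel
    rw [h2] at this
    simpa [Subgroup.mem_subgroupOf] using this
  · intro hHS hgS
    have h1 : H ≤ H' ⊓ S := le_inf hle hHS
    have h2 : Nat.card H ∣ Nat.card (H' ⊓ S : Subgroup G) := Subgroup.card_dvd_of_le h1
    have h3 : Nat.card (H' ⊓ S : Subgroup G) ∣ Nat.card H' := Subgroup.card_dvd_of_le inf_le_left
    rw [hH'] at h3
    obtain ⟨i, hi, e⟩ := (Nat.dvd_prime_pow hp.1).1 h3
    rw [hH, e] at h2
    have h4 := (Nat.pow_dvd_pow_iff_le_right hp.1.one_lt).1 h2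
    rcases Nat.lt_or_ge m i with h5 | h5
    · have : i = m + 1 := by omega
      have h6 : H' ⊓ S = H' := Subgroup.eq_of_le_of_card_ge inf_le_left (by rw [e, hH', this])
      rw [← h6]; exact inf_le_right
    · have : i = m := by omega
      have h6 : H = H' ⊓ S := Subgroup.eq_of_le_of_card_ge h1 (by rw [e, hH, this])
      exact absurd (h6 ▸ ⟨hgH', hgS⟩ : g ∈ H) hgH

theorem iter_smul (g : G) (j : ℕ) (A : Set (Fin n → ℝ)) :
    (fun A : Set (Fin n → ℝ) => g • A)^[j] A = g ^ j • A := by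
  rw [smul_iterate]

include hcont in
theorem triv_all {p : ℕ} [hp : Fact p.Prime] (m : ℕ) (hm : p ^ m ∣ Nat.card G) :
    ∃ H : Subgroup G, Nat.card H = p ^ m ∧ Ev (DH (n := n) H) (Triv (ZMod p)) := by
  induction m with
  | zero => exact ⟨⊥, by simp, triv_bot hcont _⟩
  | succ m ih =>
    obtain ⟨H, hH, hT⟩ := ih ((pow_dvd_pow p (Nat.le_succ m)).trans hm)
    obtain ⟨H', g, hH', hconj, hgp, hgen⟩ := exists_chain hH hm
    refine ⟨H', hH', ?_⟩
    have h1 := smith_step (p := p) (g := fun A : Set (Fin n → ℝ) => g • A)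
      (fun A B h => Set.smul_set_mono h) (MulAction.injective g) (DH H) (DH_mono H)
      (fun R ε => ⟨fun A hA => DH_smul hconj hA, fun A hA => by
        rw [iter_smul]; exact hA.2 _ hgp⟩) _ (base_ev hcont H g) hT
    have h2 : (fun R ε (A : Set (Fin n → ℝ)) => DH H R ε A ∧ g • A = A) = DH H' := by
      funext R ε A
      apply propext
      constructor
      · rintro ⟨⟨h3, h4⟩, h5⟩
        refine ⟨h3, fun h hh => ?_⟩
        exact (hgen (MulAction.stabilizer G A)).2.2 (fun k hk => h4 k hk) h5 hh
      · rintro ⟨h3, h4⟩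
        exact ⟨⟨h3, fun h hh => h4 h ((hgen ⊥).1 hh)⟩, h4 g (hgen ⊥).2.1⟩
    rw [h2] at h1
    exact h1

include hcont in
theorem exists_fixed {p : ℕ} (hp : p.Prime) (hpG : IsPGroup p G) :
    ∃ y : Fin n → ℝ, ∀ g : G, g • y = y := by
  haveI : Fact p.Prime := ⟨hp⟩
  by_contra hno
  push Not at hno
  obtain ⟨m, hm⟩ := IsPGroup.iff_card.1 hpG
  obtain ⟨H, hH, hT⟩ := triv_all (n := n) hcont (p := p) m hm.symm.dvd
  have hHtop : H = ⊤ := Subgroup.eq_top_of_card_eq H (by rw [hH, hm])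
  subst hHtop
  obtain ⟨R, hR, h⟩ := hT 0
  haveI := Fintype.ofFinite G
  let φ : (Fin n → ℝ) → ℝ := fun x => ∑ g : G, dist (g • x) x
  have hφ : Continuous φ := continuous_finset_sum _ fun g _ => (hcont g).dist continuous_id
  obtain ⟨x0, -, hx0⟩ := (isCompact_closedBall (0 : Fin n → ℝ) R).exists_isMinOn
    ⟨0, by simpa using hR⟩ hφ.continuousOn
  have hpos : 0 < φ x0 := by
    obtain ⟨g, hg⟩ := hno x0
    exact Finset.sum_pos' (fun _ _ => dist_nonneg) ⟨g, Finset.mem_univ g, dist_pos.2 hg⟩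
  have hc0 : (0 : ℝ) < Fintype.card G := by exact_mod_cast Fintype.card_pos
  obtain ⟨ε, hε, -, hTr⟩ := h (φ x0 / (2 * Fintype.card G)) (by positivity)
  have hnone : ∀ A : Set (Fin n → ℝ),
      ¬ DH (⊤ : Subgroup G) R (φ x0 / (2 * Fintype.card G)) A := by
    intro A hA
    obtain ⟨x, hx⟩ := hA.1.1
    have hxR : ‖x‖ ≤ R := by simpa using hA.1.2.1 x hx 1
    have h1 : φ x0 ≤ φ x := hx0 (by simpa using hxR)
    have h2 : φ x ≤ ∑ _g : G, φ x0 / (2 * Fintype.card G) := by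
      refine Finset.sum_le_sum fun g _ => ?_
      have hgx : g • x ∈ A := by
        rw [← hA.2 g trivial]; exact Set.smul_mem_smul_set hx
      simpa using hA.1.2.2 (g • x) hgx x hx 1
    rw [Finset.sum_const, Finset.card_univ, nsmul_eq_mul] at h2
    have h3 : (Fintype.card G : ℝ) * (φ x0 / (2 * Fintype.card G)) = φ x0 / 2 := by
      field_simp
    linarith
  let f : List (Set (Fin n → ℝ)) → ZMod p := fun l => match l with
    | [] => 1
    | _ :: _ => 0
  obtain ⟨w, -, hw⟩ := hTr f (by intro l₁ a l₂; cases l₁ <;> rfl) (by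
    intro l hl
    cases l with
    | nil => rfl
    | cons a l => exact absurd (hl.1 a (by simp)) (hnone a))
  have := hw [] ⟨by simp, List.Pairwise.nil⟩
  simp [f, dl] at this

end Geometry

end Smith

/-- If a finite `p`-group acts continuously on `S⁴` with at least one global fixed point,
then it has at least two global fixed points. -/
theorem pGroup_action_on_S4_fixed_point_set_not_singleton
    (p : ℕ) (hp : p.Prime) (G : Type*) [Group G] [Finite G] (hpG : IsPGroup p G)
    [MulAction G S4] (hcont : ∀ g : G, Continuous (fun x : S4 => g • x))
    (x : S4) (hx : ∀ g : G, g • x = x) :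
    ∃ y : S4, y ≠ x ∧ ∀ g : G, g • y = y := by
  haveI : Fact (Module.finrank ℝ (EuclideanSpace ℝ (Fin 5)) = 4 + 1) := ⟨by simp⟩
  let e := stereographic' 4 x
  let c := EuclideanSpace.equiv (Fin 4) ℝ
  let s : (Fin 4 → ℝ) → S4 := fun y => e.symm (c.symm y)
  let t : S4 → (Fin 4 → ℝ) := fun z => c (e z)
  have hsrc : e.source = {x}ᶜ := stereographic'_source x
  have htgt : e.target = Set.univ := stereographic'_target x
  have hts : ∀ y, t (s y) = y := by
    intro y
    simp only [t, s]
    rw [e.right_inv (by rw [htgt]; trivial)]; simp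
  have hst : ∀ z, z ≠ x → s (t z) = z := by
    intro z hz
    simp only [t, s]
    rw [ContinuousLinearEquiv.symm_apply_apply]
    exact e.left_inv (by rw [hsrc]; exact hz)
  have hsx : ∀ y, s y ≠ x := by
    intro y
    have : s y ∈ e.source := e.map_target (by rw [htgt]; trivial)
    rw [hsrc] at this; exact this
  have hgx : ∀ (g : G) z, z ≠ x → g • z ≠ x := by
    intro g z hz h
    apply hz
    rw [← hx g] at h
    exact MulAction.injective g h
  have hs : Continuous s := by
    have h1 : ContinuousOn e.symm Set.univ := htgt ▸ e.continuousOn_symm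
    exact (continuousOn_univ.1 h1).comp c.symm.continuous
  letI act : MulAction G (Fin 4 → ℝ) :=
    { smul := fun g y => t (g • s y)
      one_smul := fun y => by
        change t ((1 : G) • s y) = y
        rw [one_smul, hts]
      mul_smul := fun g h y => by
        change t ((g * h) • s y) = t (g • s (t (h • s y)))
        rw [hst _ (hgx h _ (hsx y)), mul_smul] }
  have hdef : ∀ (g : G) (y : Fin 4 → ℝ), g • y = t (g • s y) := fun _ _ => rfl
  have hc : ∀ g : G, Continuous (fun y : Fin 4 → ℝ => g • y) := by
    intro g
    have h1 : ContinuousOn t {x}ᶜ := by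
      have := e.continuousOn
      rw [hsrc] at this
      exact c.continuous.comp_continuousOn this
    exact h1.comp_continuous ((hcont g).comp hs) (fun y => hgx g _ (hsx y))
  obtain ⟨y, hy⟩ := Smith.exists_fixed hc hp hpG
  refine ⟨s y, hsx y, fun g => ?_⟩
  have := hy g
  rw [hdef] at this
  rw [← hst (g • s y) (hgx g _ (hsx y)), this]
end

section
/- Let τ : S^4 → S^4 be a free continuous involution of the 4-sphere (τ ∘ τ = id and τ(x) ≠ x for all x). Then the orbit space S^4 / τ, with the quotient topology, is homotopy equivalent to the real projective space ℝP^4. -/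
/-- Real projective 4-space: the space of lines through the origin in `ℝ⁵`, realized as
the quotient of the nonzero vectors of `ℝ⁵` by the scaling relation, with the quotient
topology. -/
def RP4 : Type :=
  Quot (fun v w : {v : EuclideanSpace ℝ (Fin 5) // v ≠ 0} =>
    ∃ c : ℝ, c • (v : EuclideanSpace ℝ (Fin 5)) = (w : EuclideanSpace ℝ (Fin 5)))

noncomputable instance : TopologicalSpace RP4 := instTopologicalSpaceQuot

/-- The orbit space of a free continuous involution `τ` of `S⁴`: the quotient of `S⁴`
by the relation identifying `x` with `τ x`, with the quotient topology. -/
def OrbitSpace (τ : S4 ≃ₜ S4) : Type := Quot (fun x y : S4 => y = τ x)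

noncomputable instance (τ : S4 ≃ₜ S4) : TopologicalSpace (OrbitSpace τ) := instTopologicalSpaceQuot

open unitInterval in
/-- Dold-type lemma: a shrinkable equivariant map onto a compact Hausdorff free `ℤ/2`-space
has an equivariant section. -/
theorem exists_equivariant_section {B E : Type*} [TopologicalSpace B] [CompactSpace B] [T2Space B]
    [TopologicalSpace E] (b : B → B) (hb : Continuous b) (hbb : ∀ x, b (b x) = x)
    (hfree : ∀ x, b x ≠ x) (e : E → E) (he : Continuous e) (hee : ∀ x, e (e x) = x)
    (p : E → B) (hpe : ∀ x, p (e x) = b (p x))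
    (s : B → E) (hs : Continuous s) (hps : ∀ x, p (s x) = x)
    (H : I × E → E) (hH : Continuous H) (hpH : ∀ t x, p (H (t, x)) = p x)
    (hH0 : ∀ x, H (0, x) = x) (hH1 : ∀ x, H (1, x) = s (p x)) :
    ∃ ς : B → E, Continuous ς ∧ (∀ x, p (ς x) = x) ∧ ∀ x, ς (b x) = e (ς x) := by
  classical
  let P : Set B → Prop := fun C => ∃ W : Set B, IsOpen W ∧ C ⊆ W ∧ (∀ x ∈ W, b x ∈ W) ∧
    ∃ ς : B → E, (∀ x ∈ W, ContinuousAt ς x) ∧ (∀ x ∈ W, p (ς x) = x) ∧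
      ∀ x ∈ W, ς (b x) = e (ς x)
  have Pmono : ∀ {C D : Set B}, C ⊆ D → P D → P C := by
    rintro C D h ⟨W, h1, h2, h3⟩
    exact ⟨W, h1, h.trans h2, h3⟩
  let Q : Set B → Prop := fun A => ∀ C : Set B, IsClosed C → (∀ x ∈ C, b x ∈ C) → P C →
    P (C ∪ (closure A ∪ b ⁻¹' closure A))
  have key : Q Set.univ := by
    refine isCompact_univ.induction_on (p := Q) ?_ ?_ ?_ ?_
    · intro C _ _ h
      simpa using h
    · intro A A' hAA h C h1 h2 h3
      refine Pmono ?_ (h C h1 h2 h3)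
      have := closure_mono hAA
      gcongr
    · intro A A' hA hA' C h1 h2 h3
      have h4 := hA C h1 h2 h3
      have h5 := hA' _ (h1.union (isClosed_closure.union (isClosed_closure.preimage hb))) ?_ h4
      · refine Pmono ?_ h5
        rw [closure_union, Set.preimage_union]
        intro x hx
        simp only [Set.mem_union] at hx ⊢
        tauto
      · rintro x (hx | hx | hx)
        · exact Or.inl (h2 x hx)
        · refine Or.inr (Or.inr ?_)
          simpa [hbb] using hx
        · exact Or.inr (Or.inl hx)
    · intro x _
      obtain ⟨U, U', hU, hU', hxU, hxU', hd⟩ := t2_separation (hfree x).symm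
      let V := U ∩ b ⁻¹' U'
      have hV : IsOpen V := hU.inter (hU'.preimage hb)
      have hVd : ∀ y ∈ V, b y ∉ V := by
        rintro y ⟨_, h1⟩ ⟨h2, _⟩
        exact Set.disjoint_left.1 hd h2 h1
      have hxV : V ∈ nhds x := hV.mem_nhds ⟨hxU, hxU'⟩
      obtain ⟨A, hA, hAc, hAV⟩ := exists_mem_nhds_isClosed_subset hxV
      refine ⟨A, mem_nhdsWithin_of_mem_nhds hA, ?_⟩
      rintro C hC hCb ⟨W, hW, hCW, hWb, ς, hςc, hςp, hςe⟩
      rw [hAc.closure_eq]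
      obtain ⟨W2, hW2, hCW2, hW2W⟩ := normal_exists_closure_subset hC hW hCW
      obtain ⟨W1, hW1, hCW1, hW1W⟩ := normal_exists_closure_subset hC hW2 hCW2
      obtain ⟨t, ht0, ht1, htI⟩ := exists_continuous_zero_one_of_isClosed
        (s := closure W1) (t := W2ᶜ) isClosed_closure hW2.isClosed_compl
        (Set.disjoint_left.2 fun y hy hy' => hy' (hW1W hy))
      let T : B → I := fun y => ⟨t y, htI y⟩
      have hT : Continuous T := t.continuous.subtype_mk _
      let ς1 : B → E := fun y => if y ∈ W then H (T y, ς y) else s y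
      have hς1c : Continuous ς1 := by
        rw [continuous_iff_continuousAt]
        intro y
        by_cases hy : y ∈ W
        · have : ContinuousAt (fun z => H (T z, ς z)) y :=
            hH.continuousAt.comp (hT.continuousAt.prodMk (hςc y hy))
          refine this.congr ?_
          filter_upwards [hW.mem_nhds hy] with z hz
          simp [ς1, hz]
        · refine hs.continuousAt.congr ?_
          have : (closure W2)ᶜ ∈ nhds y :=
            isClosed_closure.isOpen_compl.mem_nhds fun h => hy (hW2W h)
          filter_upwards [this] with z hz
          by_cases hzW : z ∈ W
          · have hTz : T z = 1 := Subtype.ext (ht1 (fun h => hz (subset_closure h)))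
            simp [ς1, hzW, hTz, hH1, hςp z hzW]
          · simp [ς1, hzW]
      have hς1p : ∀ y, p (ς1 y) = y := by
        intro y
        by_cases hy : y ∈ W
        · simp [ς1, hy, hpH, hςp y hy]
        · simp [ς1, hy, hps]
      have hς1 : ∀ y ∈ W1, ς1 y = ς y := by
        intro y hy
        have hyW : y ∈ W := hW2W (subset_closure (hW1W (subset_closure hy)))
        have hTz : T y = 0 := Subtype.ext (ht0 (subset_closure hy))
        simp [ς1, hyW, hTz, hH0]
      let W' := W1 ∩ b ⁻¹' W1
      have hW' : IsOpen W' := hW1.inter (hW1.preimage hb)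
      have hW'b : ∀ y ∈ W', b y ∈ W' := by
        rintro y ⟨h1, h2⟩
        exact ⟨h2, by simpa [hbb] using h1⟩
      have hW'W : ∀ y ∈ W', y ∈ W := fun y hy =>
        hW2W (subset_closure (hW1W (subset_closure hy.1)))
      let ς2 : B → E := fun y => if y ∈ V then ς1 y else if b y ∈ V then e (ς1 (b y)) else ς y
      have e1 : ∀ y ∈ V, ς2 y = ς1 y := fun y hy => by simp [ς2, hy]
      have e2 : ∀ y, b y ∈ V → ς2 y = e (ς1 (b y)) := fun y hy => by
        have : y ∉ V := fun h => hVd y h hy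
        simp [ς2, hy, this]
      have e3 : ∀ y ∈ W', ς2 y = ς y := fun y hy => by
        by_cases h1 : y ∈ V
        · rw [e1 y h1, hς1 y hy.1]
        · by_cases h2 : b y ∈ V
          · rw [e2 y h2, hς1 _ hy.2, hςe y (hW'W y hy), hee]
          · simp [ς2, h1, h2]
      refine ⟨W' ∪ (V ∪ b ⁻¹' V), hW'.union (hV.union (hV.preimage hb)), ?_, ?_, ς2, ?_, ?_, ?_⟩
      · apply Set.union_subset_union
        · exact fun y hy => ⟨hCW1 hy, hCW1 (hCb y hy)⟩
        · exact Set.union_subset_union hAV (Set.preimage_mono hAV)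
      · rintro y (hy | hy | hy)
        · exact Or.inl (hW'b y hy)
        · refine Or.inr (Or.inr ?_)
          simpa [hbb] using hy
        · exact Or.inr (Or.inl hy)
      · rintro y (hy | hy | hy)
        · refine (hςc y (hW'W y hy)).congr ?_
          filter_upwards [hW'.mem_nhds hy] with z hz using (e3 z hz).symm
        · refine hς1c.continuousAt.congr ?_
          filter_upwards [hV.mem_nhds hy] with z hz using (e1 z hz).symm
        · refine (he.comp (hς1c.comp hb)).continuousAt.congr ?_
          filter_upwards [(hV.preimage hb).mem_nhds hy] with z hz using (e2 z hz).symm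
      · rintro y (hy | hy | hy)
        · rw [e3 y hy, hςp y (hW'W y hy)]
        · rw [e1 y hy, hς1p]
        · rw [e2 y hy, hpe, hς1p, hbb]
      · rintro y (hy | hy | hy)
        · rw [e3 y hy, e3 _ (hW'b y hy), hςe y (hW'W y hy)]
        · rw [e1 y hy, e2 (b y) (by simpa [hbb] using hy), hbb]
        · rw [e1 (b y) hy, e2 y hy, hee]
  obtain ⟨W, hW, hCW, hWb, ς, hςc, hςp, hςe⟩ := key ∅ isClosed_empty (by simp)
    ⟨∅, isOpen_empty, le_rfl, by simp, s, by simp, by simp, by simp⟩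
  have hall : ∀ x, x ∈ W := fun x => hCW (by simp)
  exact ⟨ς, continuous_iff_continuousAt.2 fun x => hςc x (hall x), fun x => hςp x (hall x),
    fun x => hςe x (hall x)⟩
/-- The mapping path space of `f`. -/
abbrev PathE {S : Type*} [TopologicalSpace S] (f : C(S, S)) : Type _ :=
  {q : S × C(unitInterval, S) // q.2 0 = f q.1}

open unitInterval in
theorem exists_equivariant_inverse {S : Type*} [TopologicalSpace S] [CompactSpace S] [T2Space S]
    (τ ς : C(S, S)) (hττ : ∀ x, τ (τ x) = x) (hςς : ∀ x, ς (ς x) = x)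
    (hςfree : ∀ x, ς x ≠ x) (f : C(S, S)) (hf : ∀ x, f (τ x) = ς (f x))
    (hK : ContinuousMap.Homotopic f (ContinuousMap.id S)) :
    ∃ g : C(S, S), (∀ x, g (ς x) = τ (g x)) ∧
      ∃ F : ContinuousMap.Homotopy (f.comp g) (ContinuousMap.id S),
        ∀ t x, F (t, ς x) = ς (F (t, x)) := by
  obtain ⟨K⟩ := hK
  let pr : ℝ → I := Set.projIcc 0 1 zero_le_one
  have hpr : Continuous pr := continuous_projIcc
  have pr0 : ∀ r : ℝ, r ≤ 0 → pr r = 0 := fun r hr => Set.projIcc_of_le_left _ hr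
  have pr1 : ∀ r : ℝ, 1 ≤ r → pr r = 1 := fun r hr => Set.projIcc_of_right_le _ hr
  have prc : ∀ r : I, pr r = r := fun r => Set.projIcc_val _ r
  let L : (PathE f) × ℝ → S := fun q => if q.2 ≤ 0 then K (pr (-q.2), q.1.1.1) else q.1.1.2 (pr q.2)
  have hL : Continuous L := by
    refine Continuous.if_le ?_ ?_ continuous_snd continuous_const ?_
    · exact K.continuous.comp (by fun_prop)
    · fun_prop
    · intro q hq
      rw [hq, neg_zero, pr0 0 le_rfl, K.apply_zero, q.1.2]
  have Lneg : ∀ (x : (PathE f)) (r : ℝ), r ≤ 0 → L (x, r) = K (pr (-r), x.1.1) := fun x r hr => if_pos hr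
  have Lpos : ∀ (x : (PathE f)) (r : ℝ), 0 ≤ r → L (x, r) = x.1.2 (pr r) := by
    intro x r hr
    rcases hr.eq_or_lt with h | h
    · rw [← h, Lneg x 0 le_rfl, neg_zero, pr0 0 le_rfl, K.apply_zero, x.2]
    · exact if_neg (not_le.2 h)
  have L1 : ∀ (x : (PathE f)), L (x, 1) = x.1.2 1 := fun x => by rw [Lpos x 1 zero_le_one, pr1 1 le_rfl]
  have Lm1 : ∀ (x : (PathE f)), L (x, -1) = x.1.1 := fun x => by
    rw [Lneg x (-1) (by norm_num), neg_neg, pr1 1 le_rfl, K.apply_one]; rfl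
  -- phase 1
  let G1 : C((I × (PathE f)) × I, S) := ⟨fun q => L (q.1.2,
      (1 - (q.1.1 : ℝ)) * q.2 + q.1.1 * max (-2 * (q.2 : ℝ)) (4 * q.2 - 3)),
    hL.comp (by fun_prop)⟩
  have G10 : ∀ (u : I) (x : (PathE f)), G1 ((u, x), 0) = f x.1.1 := by
    intro u x
    have : G1 ((u, x), 0) = L (x, 0) := by simp [G1]
    rw [this, Lpos x 0 le_rfl, pr0 0 le_rfl, x.2]
  let H1 : C(I × (PathE f), (PathE f)) := ⟨fun q => ⟨(q.2.1.1, G1.curry q), G10 q.1 q.2⟩,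
    Continuous.subtype_mk (by fun_prop) _⟩
  -- phase 2
  let X2 : C(I × (PathE f), S) := ⟨fun q => L (q.2, 2 * (q.1 : ℝ) - 1), hL.comp (by fun_prop)⟩
  let G2 : C((I × (PathE f)) × I, S) := ⟨fun q => K (pr (2 * (q.2 : ℝ)),
      L (q.1.2, (2 * (q.1.1 : ℝ) - 1) + max (2 * (q.2 : ℝ) - 1) 0 * (2 - 2 * (q.1.1 : ℝ)))),
    K.continuous.comp (Continuous.prodMk (by fun_prop) (hL.comp (by fun_prop)))⟩
  have G20 : ∀ (u : I) (x : (PathE f)), G2 ((u, x), 0) = f (X2 (u, x)) := by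
    intro u x
    simp [G2, X2, pr0]
  let H2 : C(I × (PathE f), (PathE f)) := ⟨fun q => ⟨(X2 q, G2.curry q), G20 q.1 q.2⟩,
    Continuous.subtype_mk (by fun_prop) _⟩
  let GS : C(S × I, S) := ⟨fun q => K (pr (2 * (q.2 : ℝ)), q.1),
    K.continuous.comp (by fun_prop)⟩
  have hs0 : ∀ y : S, GS.curry y 0 = f y := fun y => by simp [GS, pr0]
  have hsc : Continuous fun y : S => (y, GS.curry y) := by fun_prop
  let s : C(S, PathE f) := ⟨fun y => ⟨(y, GS.curry y), hs0 y⟩, Continuous.subtype_mk hsc hs0⟩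
  let p : C((PathE f), S) := ⟨fun x => x.1.2 1, by fun_prop⟩
  let m : C((PathE f), (PathE f)) := ⟨fun x => H1 (1, x), by fun_prop⟩
  let P : C((PathE f), (PathE f)) → Prop := fun h => ∀ x, p (h x) = p x
  let F1 : ContinuousMap.HomotopyWith (ContinuousMap.id (PathE f)) m P :=
    { toContinuousMap := H1
      map_zero_left := by
        intro x
        refine Subtype.ext (Prod.ext rfl ?_)
        ext t
        have : (H1 (0, x)).1.2 t = L (x, t) := by simp [H1, G1]
        exact this.trans (by rw [Lpos x t t.2.1, prc]; rfl)
      map_one_left := fun x => rfl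
      prop' := by
        intro u x
        have : p (H1 (u, x)) = L (x, 1) := by
          simp only [p, H1, G1, ContinuousMap.coe_mk, ContinuousMap.curry_apply]
          congr 2
          norm_num
        exact this.trans (L1 x) }
  let F2 : ContinuousMap.HomotopyWith m (s.comp p) P :=
    { toContinuousMap := H2
      map_zero_left := by
        intro x
        refine Subtype.ext (Prod.ext ?_ ?_)
        · have : (H2 (0, x)).1.1 = L (x, -1) := by simp [H2, X2]
          exact this.trans (Lm1 x)
        · ext t
          have h1 : (H2 (0, x)).1.2 t =
            K (pr (2 * (t : ℝ)), L (x, -1 + max (2 * (t : ℝ) - 1) 0 * 2)) := by simp [H2, G2]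
          have h2 : (m x).1.2 t = L (x, max (-2 * (t : ℝ)) (4 * t - 3)) := by simp [m, H1, G1]
          refine h1.trans (Eq.trans ?_ h2.symm)
          have t0 := t.2.1
          rcases le_total (t : ℝ) (1 / 2) with h | h
          · rw [max_eq_right (by linarith), max_eq_left (by linarith), zero_mul, add_zero, Lm1,
              Lneg x _ (by linarith)]
            congr 3
            ring
          · rw [max_eq_left (by linarith), max_eq_right (by linarith), pr1 _ (by linarith),
              K.apply_one]
            simp only [ContinuousMap.id_apply]
            congr 2
            ring
      map_one_left := by
        intro x
        refine Subtype.ext (Prod.ext ?_ ?_)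
        · have : (H2 (1, x)).1.1 = L (x, 1) := by
            simp only [H2, X2, ContinuousMap.coe_mk]
            congr 2
            norm_num
          exact this.trans (L1 x)
        · ext t
          have h1 : (H2 (1, x)).1.2 t = K (pr (2 * (t : ℝ)), L (x, 1)) := by
            simp only [H2, G2, ContinuousMap.coe_mk, ContinuousMap.curry_apply]
            congr 3
            norm_num
          refine h1.trans ?_
          rw [L1]
          rfl
      prop' := by
        intro u x
        have : p (H2 (u, x)) = K (pr 2, L (x, 1)) := by
          simp only [p, H2, G2, ContinuousMap.coe_mk, ContinuousMap.curry_apply]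
          congr 3
          · norm_num
          · norm_num
        exact this.trans (by rw [pr1 2 (by norm_num), K.apply_one, L1]; rfl) }
  let F := F1.trans F2
  have he0 : ∀ x : PathE f, (ς.comp x.1.2) 0 = f (τ x.1.1) := fun x => by simp [x.2, hf]
  have hec : Continuous fun x : PathE f => (τ x.1.1, ς.comp x.1.2) := by
    have := ContinuousMap.continuous_postcomp (X := I) ς
    exact (by fun_prop : Continuous fun x : PathE f => τ x.1.1).prodMk
      (this.comp (by fun_prop : Continuous fun x : PathE f => x.1.2))
  let e : C(PathE f, PathE f) := ⟨fun x => ⟨(τ x.1.1, ς.comp x.1.2), he0 x⟩,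
    Continuous.subtype_mk hec he0⟩
  obtain ⟨w, hw, hwp, hwe⟩ := exists_equivariant_section ς ς.continuous hςς hςfree e e.continuous
    (fun x => Subtype.ext (Prod.ext (hττ _) (ContinuousMap.ext fun t => hςς _)))
    p (fun x => rfl) s s.continuous
    (fun x => by simp [p, s, GS, pr1]) F F.continuous (fun t x => F.prop t x)
    (fun x => F.apply_zero x) (fun x => F.apply_one x)
  refine ⟨⟨fun x => (w x).1.1, by fun_prop⟩, fun x => by simp [hwe, e], ?_⟩
  refine ⟨{ toFun := fun q => (w q.2).1.2 q.1
            continuous_toFun := by fun_prop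
            map_zero_left := fun x => (w x).2
            map_one_left := fun x => hwp x }, ?_⟩
  intro t x
  change (w (ς x)).1.2 t = ς ((w x).1.2 t)
  rw [hwe]
  rfl

/-- The orbit space of a self map. -/
abbrev Orb {S : Type*} (τ : S → S) : Type _ := Quot (fun x y : S => y = τ x)

/-- The map induced on orbit spaces. -/
def orbMap {S : Type*} [TopologicalSpace S] (τ ς : S → S) (f : C(S, S))
    (hf : ∀ x, f (τ x) = ς (f x)) : C(Orb τ, Orb ς) where
  toFun := Quot.lift (fun x => Quot.mk _ (f x)) (by
    rintro x _ rfl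
    exact Quot.sound (hf x))
  continuous_toFun := continuous_quot_lift _ (continuous_quot_mk.comp f.continuous)

open unitInterval in
theorem orbMap_homotopic {S : Type*} [TopologicalSpace S] (τ ς : S → S) (f g : C(S, S))
    (hf : ∀ x, f (τ x) = ς (f x)) (hg : ∀ x, g (τ x) = ς (g x))
    (F : ContinuousMap.Homotopy f g) (hF : ∀ t x, F (t, τ x) = ς (F (t, x))) :
    ContinuousMap.Homotopic (orbMap τ ς f hf) (orbMap τ ς g hg) := by
  have hq : Continuous (fun y : S => (Quot.mk _ y : Orb ς)) := continuous_quot_mk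
  let D : C(S × I, Orb ς) := ⟨fun q => Quot.mk _ (F (q.2, q.1)),
    hq.comp (F.continuous.comp (by fun_prop))⟩
  let D' : Orb τ → C(I, Orb ς) := Quot.lift (fun x => D.curry x) (by
    rintro x _ rfl
    ext t
    exact Quot.sound (hF t x))
  have hD' : Continuous D' := continuous_quot_lift _ D.curry.continuous
  refine ⟨{ toFun := fun q => D' q.2 q.1
            continuous_toFun := by fun_prop
            map_zero_left := ?_
            map_one_left := ?_ }⟩
  · rintro ⟨x⟩
    exact congrArg (Quot.mk _) (F.apply_zero x)
  · rintro ⟨x⟩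
    exact congrArg (Quot.mk _) (F.apply_one x)

theorem orb_homotopyEquiv {S : Type*} [TopologicalSpace S] [CompactSpace S] [T2Space S]
    (τ ς : C(S, S)) (hττ : ∀ x, τ (τ x) = x) (hςς : ∀ x, ς (ς x) = x)
    (hτfree : ∀ x, τ x ≠ x)
    (hςfree : ∀ x, ς x ≠ x) (f : C(S, S)) (hf : ∀ x, f (τ x) = ς (f x))
    (hK : ContinuousMap.Homotopic f (ContinuousMap.id S)) :
    Nonempty (ContinuousMap.HomotopyEquiv (Orb τ) (Orb ς)) := by
  obtain ⟨g, hg, F, hF⟩ := exists_equivariant_inverse τ ς hττ hςς hςfree f hf hK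
  have hgK : ContinuousMap.Homotopic g (ContinuousMap.id S) := by
    have h1 : ContinuousMap.Homotopic (f.comp g) g := by
      simpa using hK.comp (ContinuousMap.Homotopic.refl g)
    exact h1.symm.trans ⟨F⟩
  obtain ⟨h, hh, F', hF'⟩ := exists_equivariant_inverse ς τ hςς hττ hτfree g hg hgK
  have idm : ∀ (ρ : C(S, S)), orbMap ρ ρ (ContinuousMap.id S) (fun _ => rfl) =
      ContinuousMap.id (Orb ρ) := by
    intro ρ
    ext ⟨x⟩
    rfl
  let f' := orbMap τ ς f hf
  let g' := orbMap ς τ g hg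
  let h' := orbMap τ ς h hh
  have fg : (f'.comp g').Homotopic (ContinuousMap.id _) := by
    have := orbMap_homotopic ς ς (f.comp g) (ContinuousMap.id S) (fun x => by simp [hg, hf])
      (fun _ => rfl) F hF
    rw [idm] at this
    convert this using 1
    ext ⟨x⟩
    rfl
  have gh : (g'.comp h').Homotopic (ContinuousMap.id _) := by
    have := orbMap_homotopic τ τ (g.comp h) (ContinuousMap.id S) (fun x => by simp [hg, hh])
      (fun _ => rfl) F' hF'
    rw [idm] at this
    convert this using 1
    ext ⟨x⟩
    rfl
  have fh : f'.Homotopic h' := by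
    have h1 : (f'.comp (g'.comp h')).Homotopic f' := by
      simpa using (ContinuousMap.Homotopic.refl f').comp gh
    have h2 : ((f'.comp g').comp h').Homotopic h' := by
      simpa using fg.comp (ContinuousMap.Homotopic.refl h')
    exact h1.symm.trans h2
  have gf : (g'.comp f').Homotopic (ContinuousMap.id _) :=
    ((ContinuousMap.Homotopic.refl g').comp fh).trans gh
  exact ⟨⟨f', g', gf, fg⟩⟩

theorem neg_orb_equiv (ν : C(S4, S4)) (hν : ∀ x, (ν x : EuclideanSpace ℝ (Fin 5)) = - x) :
    Nonempty (Orb ν ≃ₜ RP4) := by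
  have nz : ∀ x : S4, (x : EuclideanSpace ℝ (Fin 5)) ≠ 0 := fun x => by
    have := x.2
    rintro h
    simp [h] at this
  let V := {v : EuclideanSpace ℝ (Fin 5) // v ≠ 0}
  let R : V → V → Prop := fun v w => ∃ c : ℝ, c • (v : EuclideanSpace ℝ (Fin 5)) = w
  have nn : ∀ v : V, ‖v.1‖⁻¹ • v.1 ∈ S4 := fun v => by
    have : ‖v.1‖ ≠ 0 := norm_ne_zero_iff.2 v.2
    simp [norm_smul, this]
  let n : V → S4 := fun v => ⟨‖v.1‖⁻¹ • v.1, nn v⟩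
  have hn : Continuous n := by
    refine Continuous.subtype_mk ?_ _
    exact (Continuous.inv₀ (by fun_prop) fun v => norm_ne_zero_iff.2 v.2).smul
      continuous_subtype_val
  let A : Orb ν → Quot R := Quot.lift (fun x => Quot.mk R ⟨x.1, nz x⟩) (by
    rintro x _ rfl
    exact Quot.sound ⟨-1, by simp [hν]⟩)
  have hA : Continuous A :=
    continuous_quot_lift _ (continuous_quot_mk.comp (continuous_subtype_val.subtype_mk _))
  let B : Quot R → Orb ν := Quot.lift (fun v => Quot.mk _ (n v)) (by
    rintro v w ⟨c, hc⟩
    have hc0 : c ≠ 0 := by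
      rintro rfl
      exact w.2 (by simpa using hc.symm)
    rcases lt_or_gt_of_ne hc0 with h | h
    · refine Quot.sound (Subtype.ext ?_)
      rw [hν]
      simp only [n, ← hc, norm_smul, smul_smul, Real.norm_eq_abs, abs_of_neg h, mul_inv]
      rw [← neg_smul]
      congr 1
      field_simp
    · refine congrArg _ (Subtype.ext ?_)
      simp only [n, ← hc, norm_smul, smul_smul, Real.norm_eq_abs, abs_of_pos h, mul_inv]
      congr 1
      field_simp)
  have hB : Continuous B := continuous_quot_lift _ (continuous_quot_mk.comp hn)
  exact ⟨{ toFun := A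
           invFun := B
           left_inv := by
             rintro ⟨x⟩
             refine congrArg (Quot.mk _) (Subtype.ext ?_)
             simp [n]
           right_inv := by
             rintro ⟨v⟩
             refine Quot.sound ⟨‖v.1‖, ?_⟩
             simp [n, smul_smul, v.2]
           continuous_toFun := hA
           continuous_invFun := hB }⟩

theorem neg_map_facts (τ : C(S4, S4)) (hinv : ∀ x, τ (τ x) = x) (hfree : ∀ x, τ x ≠ x)
    (ν : C(S4, S4)) (hν : ∀ x, (ν x : EuclideanSpace ℝ (Fin 5)) = - x) :
    ∃ f : C(S4, S4), (∀ x, f (τ x) = ν (f x)) ∧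
      ContinuousMap.Homotopic f (ContinuousMap.id S4) := by
  let N : unitInterval × S4 → EuclideanSpace ℝ (Fin 5) := fun q =>
    q.2.1 - (1 - (q.1 : ℝ)) • (τ q.2).1
  have hN : Continuous N := by fun_prop
  have nrm : ∀ x : S4, ‖x.1‖ = 1 := fun x => by simpa using x.2
  have hN0 : ∀ q, N q ≠ 0 := by
    rintro ⟨t, x⟩ h
    have h1 : x.1 = (1 - (t : ℝ)) • (τ x).1 := sub_eq_zero.1 h
    have h2 := congrArg norm h1
    have ht : 0 ≤ 1 - (t : ℝ) := by linarith [t.2.2]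
    rw [norm_smul, nrm, nrm, mul_one, Real.norm_eq_abs, abs_of_nonneg ht] at h2
    rw [← h2, one_smul] at h1
    exact hfree x (Subtype.ext h1.symm)
  have hM : ∀ q, ‖N q‖⁻¹ • N q ∈ S4 := fun q => by
    have : ‖N q‖ ≠ 0 := norm_ne_zero_iff.2 (hN0 q)
    simp [norm_smul, this]
  let M : C(unitInterval × S4, S4) := ⟨fun q => ⟨‖N q‖⁻¹ • N q, hM q⟩,
    Continuous.subtype_mk ((Continuous.inv₀ hN.norm
      fun v => norm_ne_zero_iff.2 (hN0 v)).smul hN) _⟩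
  let f : C(S4, S4) := ⟨fun x => M (0, x), by fun_prop⟩
  refine ⟨f, ?_, ⟨{ toContinuousMap := M, map_zero_left := fun x => rfl, map_one_left := ?_ }⟩⟩
  · intro x
    apply Subtype.ext
    rw [hν]
    have h : N (0, τ x) = - N (0, x) := by simp [N, hinv]
    change ‖N (0, τ x)‖⁻¹ • N (0, τ x) = -(‖N (0, x)‖⁻¹ • N (0, x))
    rw [h, norm_neg, smul_neg]
  · intro x
    apply Subtype.ext
    have h : N (1, x) = x.1 := by simp [N]
    change ‖N (1, x)‖⁻¹ • N (1, x) = x.1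
    rw [h, nrm]
    simp

/-- The orbit space of a free continuous involution of `S⁴` is homotopy equivalent
to `ℝP⁴`. -/
theorem orbit_space_of_free_involution_on_S4_homotopyEquiv_RP4
    (τ : S4 ≃ₜ S4) (hinv : ∀ x, τ (τ x) = x) (hfree : ∀ x, τ x ≠ x) :
    Nonempty (ContinuousMap.HomotopyEquiv (OrbitSpace τ) RP4) := by
  let ν : C(S4, S4) := ⟨fun x => -x, continuous_neg⟩
  have hν : ∀ x, (ν x : EuclideanSpace ℝ (Fin 5)) = - x := fun x => rfl
  let T : C(S4, S4) := ⟨τ, τ.continuous⟩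
  obtain ⟨f, hf, hK⟩ := neg_map_facts T hinv hfree ν hν
  have : CompactSpace S4 := isCompact_iff_compactSpace.1 (isCompact_sphere _ _)
  obtain ⟨e⟩ := orb_homotopyEquiv T ν hinv (fun x => neg_neg x) hfree
    (fun x h => by
      have h1 : -(x : EuclideanSpace ℝ (Fin 5)) = x := congrArg Subtype.val h
      have h2 : (x : EuclideanSpace ℝ (Fin 5)) = 0 := by
        ext i
        have h3 : -(x : EuclideanSpace ℝ (Fin 5)) i = (x : EuclideanSpace ℝ (Fin 5)) i :=
          congrArg (fun v : EuclideanSpace ℝ (Fin 5) => v i) h1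
        change (x : EuclideanSpace ℝ (Fin 5)) i = 0
        linarith
      have := x.2
      simp [h2] at this) f hf hK
  obtain ⟨e2⟩ := neg_orb_equiv ν hν
  exact ⟨e.trans e2.toHomotopyEquiv⟩
end
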